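/- Free entropy concentration with respect to the channel randomness A (Lemma G.4). Let h(A) := E_{ψ₁}[(1/n) log Z_t], viewed as a function of A = (A_μ)_{μ=1}^n, where ψ₁ = {X_μ^{(0)}, ζ_μ^{*(L)}, Z_μ}_{μ=1}^n and E_{ψ₁} is the conditional expectation over ψ₁ given the other random parameters. There exists a constant C(f,φ) such that, uniformly in t ∈ [0,1], E( h(A) − E_A[h(A)] )² ≤ C(f,φ)/n, where E_A is the conditional expectation over A. -/

import Mathlib

open MeasureTheory ProbabilityTheory

noncomputable section

/-- Standard Gaussian measure on `ℝ`. -/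
def stdG : Measure ℝ := gaussianReal 0 1

instance : IsProbabilityMeasure stdG := by unfold stdG; infer_instance

/-- Standard Gaussian measure on `Fin k → ℝ`. -/
def stdGPi (k : ℕ) : Measure (Fin k → ℝ) := Measure.pi fun _ => stdG

instance (k : ℕ) : IsProbabilityMeasure (stdGPi k) := by unfold stdGPi; infer_instance

/-- The space of weights of an `L`-hidden-layer network with widths `d 0, …, d L`. -/
abbrev Wspace (d : ℕ → ℕ) (L : ℕ) :=
  (ℓ : Fin L) → Fin (d ((ℓ : ℕ) + 1)) → Fin (d (ℓ : ℕ)) → ℝ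

/-- i.i.d. standard Gaussian measure on the weights. -/
def Wmeasure (d : ℕ → ℕ) (L : ℕ) : Measure (Wspace d L) :=
  Measure.pi fun ℓ => Measure.pi fun _ => stdGPi (d (ℓ : ℕ))

instance (d : ℕ → ℕ) (L : ℕ) : IsProbabilityMeasure (Wmeasure d L) := by
  unfold Wmeasure; infer_instance

/-- Extension of a finite collection of weight matrices to all layer indices (by zero). -/
def extW {d : ℕ → ℕ} {L : ℕ} (W : Wspace d L) (ℓ : ℕ) : Fin (d (ℓ + 1)) → Fin (d ℓ) → ℝ :=
  if h : ℓ < L then W ⟨ℓ, h⟩ else 0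

/-- Post-activations `X^{(ℓ)} = φ(W^{(ℓ)} X^{(ℓ-1)} / √d_{ℓ-1})`. -/
def feat (φ : ℝ → ℝ) (d : ℕ → ℕ) (W : (ℓ : ℕ) → Fin (d (ℓ + 1)) → Fin (d ℓ) → ℝ)
    (x0 : Fin (d 0) → ℝ) : (ℓ : ℕ) → Fin (d ℓ) → ℝ
  | 0 => x0
  | (ℓ + 1) => fun i => φ ((∑ j, W ℓ i j * feat φ d W x0 ℓ j) / Real.sqrt (d ℓ : ℝ))

/-- Output kernel `P_out(y | x)`. -/
def Pout {p : ℕ} (PA : Measure (Fin p → ℝ)) (Δ : ℝ) (f : ℝ → (Fin p → ℝ) → ℝ)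
    (y x : ℝ) : ℝ :=
  ∫ A, Real.exp (-(y - f x A) ^ 2 / (2 * Δ)) / Real.sqrt (2 * Real.pi * Δ) ∂PA

/-- The channel smeared with the extra Gaussian noise `√ε ξ`. -/
def PoutEps {p : ℕ} (PA : Measure (Fin p → ℝ)) (Δ : ℝ) (f : ℝ → (Fin p → ℝ) → ℝ)
    (ε y s : ℝ) : ℝ :=
  ∫ ξ, Pout PA Δ f y (s + Real.sqrt ε * ξ) ∂stdG

/-- The coefficients `σ_ℓ`. -/
def sigmaC (φ : ℝ → ℝ) : ℕ → ℝ
  | 0 => 1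
  | (ℓ + 1) => ∫ z, (φ (z * Real.sqrt (sigmaC φ ℓ))) ^ 2 ∂stdG

/-- The coefficients `ρ_ℓ` (meaningful for `ℓ ≥ 1`). -/
def rhoC (φ : ℝ → ℝ) (ℓ : ℕ) : ℝ :=
  ∫ z, deriv φ (z * Real.sqrt (sigmaC φ (ℓ - 1))) ∂stdG

/-- The coefficients `ε_ℓ = σ_ℓ - σ_{ℓ-1} ρ_ℓ²` (meaningful for `ℓ ≥ 1`). -/
def epsC (φ : ℝ → ℝ) (ℓ : ℕ) : ℝ :=
  sigmaC φ ℓ - sigmaC φ (ℓ - 1) * (rhoC φ ℓ) ^ 2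

/-- `d_m = min{d_0, …, d_L}`. -/
def dmin (d : ℕ → ℕ) (L : ℕ) : ℕ :=
  (Finset.range (L + 1)).inf' (Finset.nonempty_range_iff.mpr (Nat.succ_ne_zero L)) d

/-- Linear readout of the `L`-layer network: `a⊤ X^{(L)} / √d_L`. -/
def netOut (φ : ℝ → ℝ) (d : ℕ → ℕ) (L : ℕ) (W : Wspace d L) (a : Fin (d L) → ℝ)
    (x0 : Fin (d 0) → ℝ) : ℝ :=
  (∑ i, a i * feat φ d (extW W) x0 L i) / Real.sqrt (d L : ℝ)

/-- Partition function (normalisation of the Bayes posterior) of the `L`-layer model. -/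
def partFun (L p : ℕ) (PA : Measure (Fin p → ℝ)) [IsProbabilityMeasure PA]
    (Δ ρ ε : ℝ) (φ : ℝ → ℝ) (f : ℝ → (Fin p → ℝ) → ℝ) (d : ℕ → ℕ) (n : ℕ)
    (X : Fin n → Fin (d 0) → ℝ) (Y : Fin n → ℝ) : ℝ :=
  ∫ θ : Wspace d L × (Fin (d L) → ℝ),
      ∏ μ, PoutEps PA Δ f ε (Y μ) (ρ * netOut φ d L θ.1 θ.2 (X μ))
    ∂((Wmeasure d L).prod (stdGPi (d L)))

/-- Space of all the quenched randomness of the `L`-layer teacher model: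
inputs, teacher weights, readout, output noises `ξ*`, label noises `Z` and channel
randomness `A`. -/
abbrev Dspace (d : ℕ → ℕ) (L p n : ℕ) :=
  (Fin n → Fin (d 0) → ℝ) × Wspace d L × (Fin (d L) → ℝ) ×
    (Fin n → ℝ) × (Fin n → ℝ) × (Fin n → Fin p → ℝ)

/-- Law of the quenched randomness. -/
def Dmeasure (d : ℕ → ℕ) (L p n : ℕ) (PA : Measure (Fin p → ℝ))
    [IsProbabilityMeasure PA] : Measure (Dspace d L p n) :=
  (Measure.pi fun _ : Fin n => stdGPi (d 0)).prod
    ((Wmeasure d L).prod ((stdGPi (d L)).prod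
      ((stdGPi n).prod ((stdGPi n).prod (Measure.pi fun _ : Fin n => PA)))))

/-- Teacher pre-readout signal `S_μ = ρ a*⊤X_μ^{(L)}/√d_L + √ε ξ*_μ`. -/
def Ssig (φ : ℝ → ℝ) (d : ℕ → ℕ) (L p n : ℕ) (ρ ε : ℝ) (ω : Dspace d L p n)
    (μi : Fin n) : ℝ :=
  ρ * netOut φ d L ω.2.1 ω.2.2.1 (ω.1 μi) + Real.sqrt ε * ω.2.2.2.1 μi

/-- Teacher responses `Y_μ = f(S_μ; A_μ) + √Δ Z_μ`. -/
def Yresp (φ : ℝ → ℝ) (f : ℝ → (Fin p → ℝ) → ℝ) (d : ℕ → ℕ) (L n : ℕ)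
    (ρ ε Δ : ℝ) (ω : Dspace d L p n) (μi : Fin n) : ℝ :=
  f (Ssig φ d L p n ρ ε ω μi) (ω.2.2.2.2.2 μi) + Real.sqrt Δ * ω.2.2.2.2.1 μi

/-- Mutual information per sample
`(1/n) I_n = E log P_out(Y_1|S_1) - (1/n) E log Z_L(D_L)`
(the first term is written as an average over samples, all equal by symmetry). -/
def MIper (L p : ℕ) (PA : Measure (Fin p → ℝ)) [IsProbabilityMeasure PA]
    (Δ ρ ε : ℝ) (φ : ℝ → ℝ) (f : ℝ → (Fin p → ℝ) → ℝ) (d : ℕ → ℕ) (n : ℕ) : ℝ :=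
  (1 / (n : ℝ)) * ∑ μi : Fin n,
      ∫ ω, Real.log (Pout PA Δ f (Yresp φ f d L n ρ ε Δ ω μi) (Ssig φ d L p n ρ ε ω μi))
        ∂(Dmeasure d L p n PA)
    - (1 / (n : ℝ)) *
      ∫ ω, Real.log (partFun L p PA Δ ρ ε φ f d n ω.1 (Yresp φ f d L n ρ ε Δ ω))
        ∂(Dmeasure d L p n PA)


/-- `u′_y(x) = ∂_x log P_out(y|x)`. -/
def uD1 {p : ℕ} (PA : Measure (Fin p → ℝ)) (Δ : ℝ) (f : ℝ → (Fin p → ℝ) → ℝ)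
    (y x : ℝ) : ℝ := deriv (fun x' => Real.log (Pout PA Δ f y x')) x

/-- First block of quenched randomness `ψ₁ = (X, ζ*, Z)`. -/
abbrev psi1Space (d : ℕ → ℕ) (n : ℕ) :=
  (Fin n → Fin (d 0) → ℝ) × (Fin n → ℝ) × (Fin n → ℝ)

def psi1Measure (d : ℕ → ℕ) (n : ℕ) : Measure (psi1Space d n) :=
  (Measure.pi fun _ : Fin n => stdGPi (d 0)).prod ((stdGPi n).prod (stdGPi n))

instance (d : ℕ → ℕ) (n : ℕ) : IsProbabilityMeasure (psi1Measure d n) := by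
  unfold psi1Measure; infer_instance

/-- Second block `ψ₂ = (A_μ)_μ`. -/
abbrev psi2Space (p n : ℕ) := Fin n → Fin p → ℝ

def psi2Measure (p n : ℕ) (PA : Measure (Fin p → ℝ)) [IsProbabilityMeasure PA] :
    Measure (psi2Space p n) := Measure.pi fun _ : Fin n => PA

instance (p n : ℕ) (PA : Measure (Fin p → ℝ)) [IsProbabilityMeasure PA] :
    IsProbabilityMeasure (psi2Measure p n PA) := by unfold psi2Measure; infer_instance

/-- Third block `ψ₃ = (W*, a*, v*)`. -/
abbrev psi3Space (d : ℕ → ℕ) (L : ℕ) :=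
  Wspace d L × (Fin (d L) → ℝ) × (Fin (d (L - 1)) → ℝ)

def psi3Measure (d : ℕ → ℕ) (L : ℕ) : Measure (psi3Space d L) :=
  (Wmeasure d L).prod ((stdGPi (d L)).prod (stdGPi (d (L - 1))))

instance (d : ℕ → ℕ) (L : ℕ) : IsProbabilityMeasure (psi3Measure d L) := by
  unfold psi3Measure; infer_instance

/-- Full quenched randomness of the interpolating model. -/
abbrev interpSpace (d : ℕ → ℕ) (L p n : ℕ) :=
  psi1Space d n × psi2Space p n × psi3Space d L

def interpMeasure (d : ℕ → ℕ) (L p n : ℕ) (PA : Measure (Fin p → ℝ))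
    [IsProbabilityMeasure PA] : Measure (interpSpace d L p n) :=
  (psi1Measure d n).prod ((psi2Measure p n PA).prod (psi3Measure d L))

/-- Interpolating signal
`√(1−t) a⊤φ(W^{(L)}X^{(L−1)}/√d_{L−1})/√d_L + √t ρ_L v⊤X^{(L−1)}/√d_{L−1} + √(tε_L) ζ`. -/
def interpSig (φ : ℝ → ℝ) (d : ℕ → ℕ) (L : ℕ) (t : ℝ) (W : Wspace d L)
    (a : Fin (d L) → ℝ) (v : Fin (d (L - 1)) → ℝ) (ζ : ℝ) (x0 : Fin (d 0) → ℝ) : ℝ :=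
  Real.sqrt (1 - t) * netOut φ d L W a x0 +
    Real.sqrt t * rhoC φ L *
      ((∑ j, v j * feat φ d (extW W) x0 (L - 1) j) / Real.sqrt (d (L - 1) : ℝ)) +
    Real.sqrt (t * epsC φ L) * ζ

/-- Teacher interpolating signal `S_{tμ}`. -/
def StI (φ : ℝ → ℝ) (d : ℕ → ℕ) (L p n : ℕ) (t : ℝ) (ω : interpSpace d L p n)
    (μi : Fin n) : ℝ :=
  interpSig φ d L t ω.2.2.1 ω.2.2.2.1 ω.2.2.2.2 (ω.1.2.1 μi) (ω.1.1 μi)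

/-- Interpolating responses `Y_{tμ} = f(S_{tμ};A_μ) + √Δ Z_μ`. -/
def YtI (φ : ℝ → ℝ) (f : ℝ → (Fin p → ℝ) → ℝ) (d : ℕ → ℕ) (L n : ℕ) (Δ t : ℝ)
    (ω : interpSpace d L p n) (μi : Fin n) : ℝ :=
  f (StI φ d L p n t ω μi) (ω.2.1 μi) + Real.sqrt Δ * ω.1.2.2 μi

/-- Student variables `(W, a, v, ζ)` of the interpolating model. -/
abbrev studSpace (d : ℕ → ℕ) (L n : ℕ) :=
  Wspace d L × (Fin (d L) → ℝ) × (Fin (d (L - 1)) → ℝ) × (Fin n → ℝ)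

def studMeasure (d : ℕ → ℕ) (L n : ℕ) : Measure (studSpace d L n) :=
  (Wmeasure d L).prod ((stdGPi (d L)).prod ((stdGPi (d (L - 1))).prod (stdGPi n)))

instance (d : ℕ → ℕ) (L n : ℕ) : IsProbabilityMeasure (studMeasure d L n) := by
  unfold studMeasure; infer_instance

/-- Student replica `s_{tμ}`. -/
def stI (φ : ℝ → ℝ) (d : ℕ → ℕ) (L n : ℕ) (t : ℝ) (X : Fin n → Fin (d 0) → ℝ)
    (τ : studSpace d L n) (μi : Fin n) : ℝ :=
  interpSig φ d L t τ.1 τ.2.1 τ.2.2.1 (τ.2.2.2 μi) (X μi)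

/-- Interpolating partition function `Z_t`. -/
def ZtI (L p : ℕ) (PA : Measure (Fin p → ℝ)) [IsProbabilityMeasure PA] (Δ : ℝ)
    (φ : ℝ → ℝ) (f : ℝ → (Fin p → ℝ) → ℝ) (d : ℕ → ℕ) (n : ℕ) (t : ℝ)
    (ω : interpSpace d L p n) : ℝ :=
  ∫ τ, ∏ μi, Pout PA Δ f (YtI φ f d L n Δ t ω μi) (stI φ d L n t ω.1.1 τ μi)
    ∂(studMeasure d L n)

/-- The square of a mean is at most the mean of the square. -/
lemma sq_integral_le_integral_sq {α : Type*} [MeasurableSpace α] {μ : Measure α}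
    [IsProbabilityMeasure μ] {X : α → ℝ} (hX : MemLp X 2 μ) :
    (∫ x, X x ∂μ) ^ 2 ≤ ∫ x, X x ^ 2 ∂μ := by
  have h := variance_eq_sub hX
  have h0 := variance_nonneg X μ
  simp only [Pi.pow_apply] at h
  linarith

lemma memLp_two_section_ae {α β : Type*} [MeasurableSpace α] [MeasurableSpace β]
    {μ : Measure α} {ν : Measure β} [IsProbabilityMeasure μ] [IsProbabilityMeasure ν]
    {H : α × β → ℝ} (hH : MemLp H 2 (μ.prod ν)) :
    ∀ᵐ a ∂μ, MemLp (fun b => H (a, b)) 2 ν := by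
  filter_upwards [hH.integrable_sq.prod_right_ae, hH.aestronglyMeasurable.prodMk_left]
    with a h1 h2
  exact (memLp_two_iff_integrable_sq h2).2 h1

lemma memLp_two_integral_right {α β : Type*} [MeasurableSpace α] [MeasurableSpace β]
    {μ : Measure α} {ν : Measure β} [IsProbabilityMeasure μ] [IsProbabilityMeasure ν]
    {H : α × β → ℝ} (hH : MemLp H 2 (μ.prod ν)) :
    MemLp (fun a => ∫ b, H (a, b) ∂ν) 2 μ := by
  have hm : AEStronglyMeasurable (fun a => ∫ b, H (a, b) ∂ν) μ :=
    hH.aestronglyMeasurable.integral_prod_right'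
  refine (memLp_two_iff_integrable_sq hm).2 ?_
  refine hH.integrable_sq.integral_prod_left.mono' (hm.pow 2) ?_
  filter_upwards [memLp_two_section_ae hH] with a ha
  rw [Real.norm_of_nonneg (sq_nonneg _)]
  exact sq_integral_le_integral_sq ha

/-- Variance on a product space: resample the second factor, and approximate by a function that
does not depend on the first. -/
lemma variance_prod_le {α β : Type*} [MeasurableSpace α] [MeasurableSpace β]
    {μ : Measure α} {ν : Measure β} [IsProbabilityMeasure μ] [IsProbabilityMeasure ν]
    {H K : α × β → ℝ} (hH : MemLp H 2 (μ.prod ν)) (hK : MemLp K 2 (μ.prod ν))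
    (hKc : ∀ a a' b, K (a, b) = K (a', b)) :
    Var[H; μ.prod ν] ≤ (∫ a, Var[fun b => H (a, b); ν] ∂μ) +
      ∫ x, (H x - K x) ^ 2 ∂(μ.prod ν) := by
  have hm := memLp_two_integral_right hH
  have hHi : Integrable H (μ.prod ν) := hH.integrable (by norm_num)
  have hHK : MemLp (fun x => H x - K x) 2 (μ.prod ν) := hH.sub hK
  obtain ⟨a₀⟩ : Nonempty α := nonempty_of_isProbabilityMeasure μ
  have h1 : ∫ a, Var[fun b => H (a, b); ν] ∂μ =
      ∫ x, H x ^ 2 ∂(μ.prod ν) - ∫ a, (∫ b, H (a, b) ∂ν) ^ 2 ∂μ := by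
    rw [integral_prod _ hH.integrable_sq, ← integral_sub hH.integrable_sq.integral_prod_left
      hm.integrable_sq]
    refine integral_congr_ae ?_
    filter_upwards [memLp_two_section_ae hH] with a ha
    rw [variance_eq_sub ha]
    simp
  have h2 := variance_eq_sub hH
  have h3 := variance_eq_sub hm
  rw [integral_prod _ hHi] at h2
  have h4 : Var[fun a => ∫ b, H (a, b) ∂ν; μ] ≤ ∫ x, (H x - K x) ^ 2 ∂(μ.prod ν) := by
    rw [← variance_sub_const hm.aestronglyMeasurable (∫ b, K (a₀, b) ∂ν)]
    refine (variance_le_expectation_sq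
      (hm.aestronglyMeasurable.sub aestronglyMeasurable_const)).trans ?_
    rw [integral_prod _ hHK.integrable_sq]
    refine integral_mono_ae
      (hm.sub (memLp_const _)).integrable_sq hHK.integrable_sq.integral_prod_left ?_
    filter_upwards [memLp_two_section_ae hHK, memLp_two_section_ae hH, memLp_two_section_ae hK]
      with a ha hb hc
    have : ∫ b, H (a, b) ∂ν - ∫ b, K (a₀, b) ∂ν = ∫ b, (H (a, b) - K (a, b)) ∂ν := by
      rw [integral_sub (hb.integrable (by norm_num)) (hc.integrable (by norm_num))]
      simp_rw [hKc a a₀]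
    rw [Pi.pow_apply, Pi.sub_apply, this]
    exact sq_integral_le_integral_sq ha
  simp only [Pi.pow_apply] at h2 h3
  linarith

/-- **Efron–Stein inequality** in leave-one-out form. -/
theorem variance_pi_le_sum {E : Type*} [MeasurableSpace E] (κ : Measure E)
    [IsProbabilityMeasure κ] : ∀ (n : ℕ) (h : (Fin n → E) → ℝ) (g : Fin n → (Fin n → E) → ℝ),
    MemLp h 2 (Measure.pi fun _ => κ) → (∀ i, MemLp (g i) 2 (Measure.pi fun _ => κ)) →
    (∀ i a e, g i (Function.update a i e) = g i a) →
    Var[h; Measure.pi fun _ => κ] ≤ ∑ i, ∫ a, (h a - g i a) ^ 2 ∂(Measure.pi fun _ => κ)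
  | 0, h, g, hh, hg, hgi => by
    have : h = fun _ => h default := by ext a; rw [Subsingleton.elim a default]
    rw [this, variance_eq_sub (memLp_const _)]
    simp
  | n + 1, h, g, hh, hg, hgi => by
    have hT := (measurePreserving_piFinSuccAbove (fun _ : Fin (n + 1) => κ) 0).symm
    set T := (MeasurableEquiv.piFinSuccAbove (fun _ : Fin (n + 1) => E) 0).symm with hTdef
    have hTa : ∀ e b, T (e, b) = Fin.cons e b := fun e b => by
      simp [hTdef, MeasurableEquiv.piFinSuccAbove, Fin.insertNthEquiv]
    have hH := hh.comp_measurePreserving hT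
    have hG := fun i => (hg i).comp_measurePreserving hT
    have hHG := fun i => (hH.sub (hG i)).integrable_sq
    rw [← hT.variance_fun_comp hh.aestronglyMeasurable.aemeasurable]
    have key : ∀ i, ∫ a, (h a - g i a) ^ 2 ∂(Measure.pi fun _ => κ) =
        ∫ x, (h (T x) - g i (T x)) ^ 2 ∂(κ.prod (Measure.pi fun _ : Fin n => κ)) := fun i =>
      (hT.integral_comp' (fun a => (h a - g i a) ^ 2)).symm
    simp_rw [key]
    rw [Fin.sum_univ_succ]
    refine le_trans ?_ (add_comm _ _).le
    refine (variance_prod_le hH (hG 0) ?_).trans (add_le_add ?_ le_rfl)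
    · intro a a' b
      simp only [Function.comp, hTa]
      rw [← hgi 0 (Fin.cons a' b) a, Fin.update_cons_zero]
    · have hi : ∀ i, ∫ x, (h (T x) - g i (T x)) ^ 2 ∂(κ.prod (Measure.pi fun _ : Fin n => κ)) =
          ∫ e, ∫ b, (h (T (e, b)) - g i (T (e, b))) ^ 2 ∂(Measure.pi fun _ => κ) ∂κ := fun i =>
        integral_prod _ (hHG i)
      simp_rw [hi]
      rw [← integral_finsetSum _ fun i _ => (hHG i.succ).integral_prod_left]
      refine integral_mono_of_nonneg (ae_of_all _ fun _ => variance_nonneg _ _)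
        (integrable_finsetSum _ fun i _ => (hHG i.succ).integral_prod_left) ?_
      filter_upwards [memLp_two_section_ae hH,
        ae_all_iff.2 fun i : Fin n => memLp_two_section_ae (hG i.succ)] with e he hge
      refine variance_pi_le_sum κ n _ (fun i b => g i.succ (T (e, b))) he hge ?_
      intro i b e'
      simp only [hTa, Fin.cons_update, hgi]

lemma lintegral_pi_prod {U : Type*} [MeasurableSpace U] : ∀ (n : ℕ) (μ : Fin n → Measure U)
    [∀ i, SigmaFinite (μ i)] (f : Fin n → U → ENNReal), (∀ i, Measurable (f i)) →
    ∫⁻ u, ∏ i, f i (u i) ∂(Measure.pi μ) = ∏ i, ∫⁻ x, f i x ∂(μ i)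
  | 0, μ, _, f, hf => by simp
  | n + 1, μ, _, f, hf => by
    have hT := (measurePreserving_piFinSuccAbove μ 0).symm
    rw [← hT.lintegral_comp (by fun_prop), Fin.prod_univ_succ,
      ← lintegral_pi_prod n (fun i => μ i.succ) (fun i => f i.succ) fun i => hf _]
    have hprod : Measurable fun u : Fin n → U => ∏ i, f i.succ (u i) :=
      Finset.measurable_prod _ fun i _ => (hf _).comp (measurable_pi_apply i)
    rw [← lintegral_prod_mul (hf 0).aemeasurable hprod.aemeasurable]
    refine lintegral_congr fun x => ?_
    simp [MeasurableEquiv.piFinSuccAbove, Fin.insertNthEquiv, Fin.prod_univ_succ]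

lemma pi_withDensity_prod {U : Type*} [MeasurableSpace U] (lam : Measure U) [SigmaFinite lam]
    (ρ : U → ENNReal) (hρ : Measurable ρ) [SigmaFinite (lam.withDensity ρ)] (n : ℕ) :
    Measure.pi (fun _ : Fin n => lam.withDensity ρ) =
      (Measure.pi fun _ => lam).withDensity fun u => ∏ i, ρ (u i) := by
  refine Measure.pi_eq fun s hs => ?_
  rw [withDensity_apply _ (MeasurableSet.univ_pi hs), Measure.restrict_pi_pi,
    lintegral_pi_prod n _ _ fun _ => hρ]
  exact Finset.prod_congr rfl fun i _ => (withDensity_apply _ (hs i)).symm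

/-- Jensen's inequality for the squared logarithm of a weighted average of a function with
values in `(0, B]`. -/
lemma sq_log_weighted_mean_le {Θ : Type*} [MeasurableSpace Θ] {π : Measure Θ}
    [IsProbabilityMeasure π] {w q : Θ → ℝ} {B : ℝ} (hwm : Measurable w) (hwi : Integrable w π)
    (hw : ∀ θ, 0 < w θ) (hqm : Measurable q) (hq : ∀ θ, 0 < q θ) (hqB : ∀ θ, q θ ≤ B) :
    ENNReal.ofReal ((Real.log (∫ θ, w θ * q θ ∂π) - Real.log (∫ θ, w θ ∂π) - Real.log B) ^ 2) *
        ENNReal.ofReal (∫ θ, w θ ∂π) ≤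
      ∫⁻ θ, ENNReal.ofReal (w θ) * ENNReal.ofReal ((Real.log B - Real.log (q θ)) ^ 2) ∂π := by
  obtain ⟨θ₀⟩ : Nonempty Θ := nonempty_of_isProbabilityMeasure π
  have hB : 0 < B := (hq θ₀).trans_le (hqB θ₀)
  have hwq : Integrable (fun θ => w θ * q θ) π :=
    hwi.mul_bdd hqm.aestronglyMeasurable
      (ae_of_all _ fun θ => by rw [Real.norm_of_nonneg (hq θ).le]; exact hqB θ)
  have pos : ∀ g : Θ → ℝ, Integrable g π → (∀ θ, 0 < g θ) → 0 < ∫ θ, g θ ∂π := fun g hg h => by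
    rw [integral_pos_iff_support_of_nonneg (fun θ => (h θ).le) hg]
    have : Function.support g = Set.univ := Set.eq_univ_of_forall fun θ => (h θ).ne'
    simp [this]
  have hI := pos _ hwi hw
  have hJ := pos _ hwq fun θ => mul_pos (hw θ) (hq θ)
  set I := ∫ θ, w θ ∂π
  set J := ∫ θ, w θ * q θ ∂π
  have hJI : J ≤ I * B := by
    rw [← integral_mul_const]
    exact integral_mono hwq (hwi.mul_const B)
      fun θ => mul_le_mul_of_nonneg_left (hqB θ) (hw θ).le
  simp_rw [← ENNReal.ofReal_mul (hw _).le]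
  rw [← ENNReal.ofReal_mul (sq_nonneg _)]
  have hmeas : Measurable fun θ => w θ * (Real.log B - Real.log (q θ)) ^ 2 := by fun_prop
  have hnn : ∀ θ, 0 ≤ w θ * (Real.log B - Real.log (q θ)) ^ 2 := fun θ =>
    mul_nonneg (hw θ).le (sq_nonneg _)
  by_cases hfin : ∫⁻ θ, ENNReal.ofReal (w θ * (Real.log B - Real.log (q θ)) ^ 2) ∂π = ⊤
  · rw [hfin]; exact le_top
  have hwi_sq : Integrable (fun θ => w θ * (Real.log B - Real.log (q θ)) ^ 2) π :=
    ⟨hmeas.aestronglyMeasurable, by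
      rw [hasFiniteIntegral_iff_ofReal (ae_of_all _ hnn)]; exact lt_top_iff_ne_top.2 hfin⟩
  rw [← ofReal_integral_eq_lintegral_ofReal hwi_sq (ae_of_all _ hnn)]
  refine ENNReal.ofReal_le_ofReal ?_
  set r := Real.log I + Real.log B - Real.log J with hr
  have hr0 : 0 ≤ r := by
    have := Real.log_le_log hJ hJI
    rw [Real.log_mul hI.ne' hB.ne'] at this
    linarith
  have her : Real.exp r = I * B / J := by
    rw [hr, Real.exp_sub, Real.exp_add, Real.exp_log hI, Real.exp_log hB, Real.exp_log hJ]
  have hpt : ∀ θ, w θ * (r ^ 2 + 2 * r) - w θ * q θ * (2 * r * Real.exp r / B) ≤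
      w θ * (Real.log B - Real.log (q θ)) ^ 2 := fun θ => by
    have h1 := Real.add_one_le_exp (r - (Real.log B - Real.log (q θ)))
    have h2 : Real.exp (r - (Real.log B - Real.log (q θ))) = Real.exp r * q θ / B := by
      rw [Real.exp_sub r, Real.exp_sub (Real.log B), Real.exp_log hB, Real.exp_log (hq θ)]
      field_simp
    rw [h2] at h1
    have h3 := mul_le_mul_of_nonneg_left h1 (by positivity : 0 ≤ 2 * r)
    have h4 : r ^ 2 + 2 * r - 2 * r * (Real.exp r * q θ / B) ≤
        (Real.log B - Real.log (q θ)) ^ 2 := by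
      nlinarith [sq_nonneg (r - (Real.log B - Real.log (q θ)))]
    calc _ = w θ * (r ^ 2 + 2 * r - 2 * r * (Real.exp r * q θ / B)) := by ring
      _ ≤ _ := mul_le_mul_of_nonneg_left h4 (hw θ).le
  have := integral_mono ((hwi.mul_const _).sub (hwq.mul_const _)) hwi_sq hpt
  simp only [Pi.sub_apply] at this
  rw [integral_sub (hwi.mul_const _) (hwq.mul_const _), integral_mul_const,
    integral_mul_const] at this
  refine le_trans (le_of_eq ?_) this
  change _ = I * (r ^ 2 + 2 * r) - J * (2 * r * Real.exp r / B)
  rw [her]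
  have : Real.log J - Real.log I - Real.log B = -r := by rw [hr]; ring
  rw [this]
  field_simp
  ring

section LeaveOneOut

variable {Θ V U : Type*} [MeasurableSpace Θ] [MeasurableSpace V] [MeasurableSpace U]

/-- Log-partition function of the posterior with prior `π` and likelihood `q`. -/
def logPart (π : Measure Θ) (q : Θ → U → ℝ) {n : ℕ} (u : Fin n → U) : ℝ :=
  Real.log (∫ θ, ∏ j, q θ (u j) ∂π)

lemma integrable_prod_likelihood {π : Measure Θ} [IsProbabilityMeasure π] {q : Θ → U → ℝ}
    {B : ℝ} (hqm : Measurable (Function.uncurry q)) (hq : ∀ θ u, 0 < q θ u)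
    (hqB : ∀ θ u, q θ u ≤ B) {n : ℕ} (u : Fin n → U) :
    Integrable (fun θ => ∏ j, q θ (u j)) π := by
  refine Integrable.of_bound (C := B ^ n) ?_ (ae_of_all _ fun θ => ?_)
  · exact (Finset.measurable_prod _ fun j _ => hqm.of_uncurry_right).aestronglyMeasurable
  · rw [Real.norm_of_nonneg (Finset.prod_nonneg fun j _ => (hq _ _).le)]
    refine (Finset.prod_le_prod (fun j _ => (hq _ _).le) fun j _ => hqB θ (u j)).trans ?_
    simp

lemma measurable_logPart {π : Measure Θ} [IsProbabilityMeasure π] {q : Θ → U → ℝ}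
    (hqm : Measurable (Function.uncurry q)) (n : ℕ) :
    Measurable fun u : Fin n → U => logPart π q u := by
  refine Real.measurable_log.comp (StronglyMeasurable.measurable ?_)
  refine StronglyMeasurable.integral_prod_right (f := fun (u : Fin n → U) θ => ∏ j, q θ (u j)) ?_
  refine Measurable.stronglyMeasurable (Finset.measurable_prod _ fun j _ => ?_)
  exact hqm.comp (measurable_snd.prodMk ((measurable_pi_apply j).comp measurable_fst))

/-- Nishimori identity, as an inequality: averaging a posterior expectation over the data gives
back the prior expectation. -/
lemma lintegral_posterior_le {π : Measure Θ} [IsProbabilityMeasure π] {lam : Measure U}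
    [SigmaFinite lam] {q : Θ → U → ℝ} {B : ℝ} (hqm : Measurable (Function.uncurry q))
    (hq : ∀ θ u, 0 < q θ u) (hqB : ∀ θ u, q θ u ≤ B)
    (hprob : ∀ θ, IsProbabilityMeasure (lam.withDensity fun u => ENNReal.ofReal (q θ u)))
    {S : Θ → ENNReal} (hS : Measurable S) (n : ℕ) :
    ∫⁻ θ', ∫⁻ u, (∫⁻ θ, ENNReal.ofReal (∏ j, q θ (u j)) * S θ ∂π) /
        ENNReal.ofReal (∫ θ, ∏ j, q θ (u j) ∂π)
      ∂(Measure.pi fun _ : Fin n => lam.withDensity fun u => ENNReal.ofReal (q θ' u)) ∂π ≤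
    ∫⁻ θ, S θ ∂π := by
  have hof : ∀ θ (u : Fin n → U), ENNReal.ofReal (∏ j, q θ (u j)) =
      ∏ j, ENNReal.ofReal (q θ (u j)) := fun θ u =>
    ENNReal.ofReal_prod_of_nonneg fun j _ => (hq _ _).le
  have hWm : Measurable fun x : Θ × (Fin n → U) => ∏ j, ENNReal.ofReal (q x.1 (x.2 j)) :=
    Finset.measurable_prod _ fun j _ => ENNReal.measurable_ofReal.comp
      (hqm.comp (measurable_fst.prodMk ((measurable_pi_apply j).comp measurable_snd)))
  have hZ : ∀ u : Fin n → U, ENNReal.ofReal (∫ θ, ∏ j, q θ (u j) ∂π) =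
      ∫⁻ θ, ∏ j, ENNReal.ofReal (q θ (u j)) ∂π := fun u => by
    rw [ofReal_integral_eq_lintegral_ofReal (integrable_prod_likelihood hqm hq hqB u)
      (ae_of_all _ fun θ => Finset.prod_nonneg fun j _ => (hq _ _).le)]
    simp_rw [hof]
  simp_rw [hZ, hof]
  have hZm : Measurable fun u : Fin n → U => ∫⁻ θ, ∏ j, ENNReal.ofReal (q θ (u j)) ∂π :=
    hWm.lintegral_prod_left'
  have hNm : Measurable fun u : Fin n → U =>
      ∫⁻ θ, (∏ j, ENNReal.ofReal (q θ (u j))) * S θ ∂π :=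
    (hWm.mul (hS.comp measurable_fst)).lintegral_prod_left'
  have hrow : ∀ θ, Measurable fun u => ENNReal.ofReal (q θ u) := fun θ =>
    ENNReal.measurable_ofReal.comp hqm.of_uncurry_left
  have hWl : ∀ u : Fin n → U, Measurable fun θ => ∏ j, ENNReal.ofReal (q θ (u j)) := fun u =>
    hWm.comp (measurable_prodMk_right (y := u))
  have hWr : ∀ θ, Measurable fun u : Fin n → U => ∏ j, ENNReal.ofReal (q θ (u j)) := fun θ =>
    hWm.comp (measurable_prodMk_left (x := θ))
  have h1 : ∀ θ', ∫⁻ u, (∫⁻ θ, (∏ j, ENNReal.ofReal (q θ (u j))) * S θ ∂π) /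
        (∫⁻ θ, ∏ j, ENNReal.ofReal (q θ (u j)) ∂π)
      ∂(Measure.pi fun _ : Fin n => lam.withDensity fun u => ENNReal.ofReal (q θ' u)) =
      ∫⁻ u : Fin n → U, (∏ j, ENNReal.ofReal (q θ' (u j))) *
        ((∫⁻ θ, (∏ j, ENNReal.ofReal (q θ (u j))) * S θ ∂π) /
        (∫⁻ θ, ∏ j, ENNReal.ofReal (q θ (u j)) ∂π)) ∂(Measure.pi fun _ => lam) := fun θ' => by
    have := hprob θ'
    rw [pi_withDensity_prod lam _ (hrow θ')]
    exact lintegral_withDensity_eq_lintegral_mul _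
      (hWr θ') (hNm.div hZm)
  simp_rw [h1]
  rw [lintegral_lintegral_swap]
  swap
  · exact (hWm.mul ((hNm.div hZm).comp measurable_snd)).aemeasurable
  calc _ ≤ ∫⁻ u, ∫⁻ θ, (∏ j, ENNReal.ofReal (q θ (u j))) * S θ ∂π ∂(Measure.pi fun _ => lam) := by
        refine lintegral_mono fun u => ?_
        rw [lintegral_mul_const _ (hWl u)]
        exact ENNReal.mul_div_le
    _ = ∫⁻ θ, S θ ∂π := by
        have hswap : Measurable (Function.uncurry fun (u : Fin n → U) θ =>
            (∏ j, ENNReal.ofReal (q θ (u j))) * S θ) :=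
          (hWm.mul (hS.comp measurable_fst)).comp measurable_swap
        rw [lintegral_lintegral_swap hswap.aemeasurable]
        refine lintegral_congr fun θ => ?_
        rw [lintegral_mul_const _ (hWr θ),
          lintegral_pi_prod n _ _ fun _ => hrow θ]
        have := (hprob θ).measure_univ
        rw [withDensity_apply _ MeasurableSet.univ, Measure.restrict_univ] at this
        simp [this]

/-- The increment of the log-partition function produced by one observation has second moment
bounded uniformly in the number of observations. -/
lemma lintegral_sq_logPart_sub_le {π : Measure Θ} [IsProbabilityMeasure π] {κ : Measure V}
    [IsProbabilityMeasure κ] {lam : Measure U} [SigmaFinite lam] {o : Θ → V → U} {q : Θ → U → ℝ}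
    {B : ℝ} (hom : Measurable (Function.uncurry o)) (hqm : Measurable (Function.uncurry q))
    (hq : ∀ θ u, 0 < q θ u) (hqB : ∀ θ u, q θ u ≤ B)
    (hlaw : ∀ θ, κ.map (o θ) = lam.withDensity fun u => ENNReal.ofReal (q θ u))
    {S : Θ → ENNReal} (hS : Measurable S)
    (hRS : ∀ θ' θ, ∫⁻ v, ENNReal.ofReal ((Real.log B - Real.log (q θ (o θ' v))) ^ 2) ∂κ ≤
      S θ' + S θ) (m : ℕ) (i : Fin (m + 1)) :
    ∫⁻ θ', ∫⁻ v, ENNReal.ofReal ((logPart π q (fun j => o θ' (v j)) -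
        (logPart π q (fun j => o θ' (v (i.succAbove j))) + Real.log B)) ^ 2)
      ∂(Measure.pi fun _ : Fin (m + 1) => κ) ∂π ≤ 2 * ∫⁻ θ, S θ ∂π := by
  have hor : ∀ θ, Measurable (o θ) := fun θ => hom.of_uncurry_left
  have hprob : ∀ θ, IsProbabilityMeasure (lam.withDensity fun u => ENNReal.ofReal (q θ u)) :=
    fun θ => hlaw θ ▸ Measure.isProbabilityMeasure_map (hor θ).aemeasurable
  have hT := (measurePreserving_piFinSuccAbove (fun _ : Fin (m + 1) => κ) i).symm
  have hlm := fun n => measurable_logPart (π := π) hqm n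
  have hwm : ∀ u : Fin m → U, Measurable fun θ => ∏ j, q θ (u j) := fun u =>
    Finset.measurable_prod _ fun j _ => hqm.of_uncurry_right
  have hwmj : Measurable fun x : Θ × (Fin m → U) => ∏ j, q x.1 (x.2 j) :=
    Finset.measurable_prod _ fun j _ =>
      hqm.comp (measurable_fst.prodMk ((measurable_pi_apply j).comp measurable_snd))
  set Φ : (Fin m → U) → ENNReal := fun u => (∫⁻ θ, ENNReal.ofReal (∏ j, q θ (u j)) * S θ ∂π) /
        ENNReal.ofReal (∫ θ, ∏ j, q θ (u j) ∂π) with hΦ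
  have hZm : Measurable fun u : Fin m → U => ∫ θ, ∏ j, q θ (u j) ∂π := by
    refine (StronglyMeasurable.integral_prod_right
      (f := fun (u : Fin m → U) θ => ∏ j, q θ (u j)) ?_).measurable
    exact (hwmj.comp measurable_swap).stronglyMeasurable
  have hΦm : Measurable Φ := by
    refine Measurable.div ?_ (ENNReal.measurable_ofReal.comp hZm)
    exact Measurable.lintegral_prod_left' (f := fun x : Θ × (Fin m → U) =>
      ENNReal.ofReal (∏ j, q x.1 (x.2 j)) * S x.1)
      ((ENNReal.measurable_ofReal.comp hwmj).mul (hS.comp measurable_fst))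
  have step : ∀ θ' (b : Fin m → V), ∫⁻ e, ENNReal.ofReal ((logPart π q
        (fun j => o θ' ((i.insertNth e b : Fin (m + 1) → V) j)) -
        (logPart π q (fun j => o θ' (b j)) + Real.log B)) ^ 2) ∂κ ≤
      S θ' + Φ fun j => o θ' (b j) := by
    intro θ' b
    set w : Θ → ℝ := fun θ => ∏ j, q θ (o θ' (b j)) with hw
    have hwi : Integrable w π := integrable_prod_likelihood hqm hq hqB _
    have hwpos : ∀ θ, 0 < w θ := fun θ => Finset.prod_pos fun j _ => hq _ _
    have hI : 0 < ∫ θ, w θ ∂π := by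
      rw [integral_pos_iff_support_of_nonneg (fun θ => (hwpos θ).le) hwi]
      have : Function.support w = Set.univ := Set.eq_univ_of_forall fun θ => (hwpos θ).ne'
      simp [this]
    have hI0 : ENNReal.ofReal (∫ θ, w θ ∂π) ≠ 0 := by simpa using hI
    have hIw : ENNReal.ofReal (∫ θ, w θ ∂π) = ∫⁻ θ, ENNReal.ofReal (w θ) ∂π :=
      ofReal_integral_eq_lintegral_ofReal hwi (ae_of_all _ fun θ => (hwpos θ).le)
    have hRm : Measurable fun x : V × Θ => ENNReal.ofReal (w x.2) *
        ENNReal.ofReal ((Real.log B - Real.log (q x.2 (o θ' x.1))) ^ 2) := by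
      have h1 : Measurable fun x : V × Θ => q x.2 (o θ' x.1) :=
        hqm.comp (measurable_snd.prodMk ((hor θ').comp measurable_fst))
      have h2 : Measurable w := hwm _
      fun_prop
    calc _ ≤ ∫⁻ e, (∫⁻ θ, ENNReal.ofReal (w θ) *
          ENNReal.ofReal ((Real.log B - Real.log (q θ (o θ' e))) ^ 2) ∂π) /
            ENNReal.ofReal (∫ θ, w θ ∂π) ∂κ := by
          refine lintegral_mono fun e => ?_
          rw [ENNReal.le_div_iff_mul_le (Or.inl hI0) (Or.inl ENNReal.ofReal_ne_top)]
          refine le_trans (le_of_eq ?_) (sq_log_weighted_mean_le (hwm _) hwi hwpos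
            (hqm.of_uncurry_right (y := o θ' e)) (fun θ => hq θ _) fun θ => hqB θ _)
          have : ∀ θ, ∏ j, q θ (o θ' ((i.insertNth e b : Fin (m + 1) → V) j)) =
              w θ * q θ (o θ' e) := fun θ => by
            rw [Fin.prod_univ_succAbove _ i, mul_comm]
            simp [hw]
          simp only [logPart, this]
          rw [sub_add_eq_sub_sub]
      _ = (∫⁻ θ, ENNReal.ofReal (w θ) * ∫⁻ e,
          ENNReal.ofReal ((Real.log B - Real.log (q θ (o θ' e))) ^ 2) ∂κ ∂π) /
            ENNReal.ofReal (∫ θ, w θ ∂π) := by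
          simp_rw [div_eq_mul_inv]
          rw [lintegral_mul_const _ hRm.lintegral_prod_right', lintegral_lintegral_swap
            (f := fun e θ => ENNReal.ofReal (w θ) *
              ENNReal.ofReal ((Real.log B - Real.log (q θ (o θ' e))) ^ 2)) hRm.aemeasurable]
          congr 1
          refine lintegral_congr fun θ => ?_
          rw [lintegral_const_mul']
          exact ENNReal.ofReal_ne_top
      _ ≤ (∫⁻ θ, (S θ' * ENNReal.ofReal (w θ) + ENNReal.ofReal (w θ) * S θ) ∂π) /
            ENNReal.ofReal (∫ θ, w θ ∂π) := by
          gcongr with θ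
          rw [mul_comm (S θ'), ← mul_add]
          gcongr
          exact hRS θ' θ
      _ ≤ _ := by
          have hwe : Measurable fun θ => ENNReal.ofReal (w θ) := (hwm _).ennreal_ofReal
          rw [lintegral_add_left (hwe.const_mul _), lintegral_const_mul _ hwe, ENNReal.add_div,
            ← hIw, mul_div_assoc, ENNReal.div_self hI0 ENNReal.ofReal_ne_top, mul_one]
  calc _ = ∫⁻ θ', ∫⁻ b, ∫⁻ e, ENNReal.ofReal ((logPart π q
        (fun j => o θ' ((i.insertNth e b : Fin (m + 1) → V) j)) -
        (logPart π q (fun j => o θ' (b j)) + Real.log B)) ^ 2) ∂κ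
        ∂(Measure.pi fun _ : Fin m => κ) ∂π := by
        refine lintegral_congr fun θ' => ?_
        have hm : Measurable fun v : Fin (m + 1) → V =>
            ENNReal.ofReal ((logPart π q (fun j => o θ' (v j)) -
              (logPart π q (fun j => o θ' (v (i.succAbove j))) + Real.log B)) ^ 2) := by
          have h1 : Measurable fun v : Fin (m + 1) → V => logPart π q (fun j => o θ' (v j)) :=
            (hlm _).comp (measurable_pi_lambda _ fun j => (hor θ').comp (measurable_pi_apply j))
          have h2 : Measurable fun v : Fin (m + 1) → V =>
              logPart π q (fun j => o θ' (v (i.succAbove j))) :=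
            (hlm _).comp (measurable_pi_lambda _ fun j => (hor θ').comp (measurable_pi_apply _))
          fun_prop
        rw [← hT.lintegral_comp hm]
        refine (lintegral_prod_symm _
          (hm.comp (MeasurableEquiv.measurable _)).aemeasurable).trans ?_
        simp [MeasurableEquiv.piFinSuccAbove, Fin.insertNthEquiv]
    _ ≤ ∫⁻ θ', (S θ' + ∫⁻ u, Φ u ∂(Measure.pi fun _ : Fin m =>
          lam.withDensity fun u => ENNReal.ofReal (q θ' u))) ∂π := by
        refine lintegral_mono fun θ' => ?_
        refine (lintegral_mono fun b => step θ' b).trans ?_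
        have := hprob θ'
        have : SigmaFinite (κ.map (o θ')) := by rw [hlaw]; infer_instance
        rw [lintegral_add_left measurable_const, lintegral_const, measure_univ, mul_one, ← hlaw,
          ← Measure.pi_map_pi (μ := fun _ : Fin m => κ) fun _ => (hor θ').aemeasurable,
          lintegral_map hΦm]
        exact measurable_pi_lambda _ fun j => (hor θ').comp (measurable_pi_apply j)
    _ ≤ _ := by
        rw [lintegral_add_left hS, two_mul]
        exact add_le_add le_rfl (lintegral_posterior_le hqm hq hqB hprob hS m)

lemma memLp_two_logPart {π : Measure Θ} [IsProbabilityMeasure π] {κ : Measure V}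
    [IsProbabilityMeasure κ] {lam : Measure U} [SigmaFinite lam] {o : Θ → V → U} {q : Θ → U → ℝ}
    {B : ℝ} (hom : Measurable (Function.uncurry o)) (hqm : Measurable (Function.uncurry q))
    (hq : ∀ θ u, 0 < q θ u) (hqB : ∀ θ u, q θ u ≤ B)
    (hlaw : ∀ θ, κ.map (o θ) = lam.withDensity fun u => ENNReal.ofReal (q θ u))
    {S : Θ → ENNReal} (hS : Measurable S)
    (hRS : ∀ θ' θ, ∫⁻ v, ENNReal.ofReal ((Real.log B - Real.log (q θ (o θ' v))) ^ 2) ∂κ ≤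
      S θ' + S θ) (hSfin : ∫⁻ θ, S θ ∂π ≠ ⊤) : ∀ n : ℕ,
    MemLp (fun x : Θ × (Fin n → V) => logPart π q fun j => o x.1 (x.2 j)) 2
      (π.prod (Measure.pi fun _ => κ))
  | 0 => by simp [logPart]
  | n + 1 => by
    have hm : ∀ k, Measurable fun x : Θ × (Fin k → V) => logPart π q fun j => o x.1 (x.2 j) :=
      fun k => (measurable_logPart hqm k).comp (measurable_pi_lambda _ fun j =>
        hom.comp (measurable_fst.prodMk ((measurable_pi_apply j).comp measurable_snd)))
    have hdrop : MeasurePreserving (fun v : Fin (n + 1) → V => fun j => v ((0 : Fin (n + 1)).succAbove j))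
        (Measure.pi fun _ => κ) (Measure.pi fun _ => κ) :=
      measurePreserving_snd.comp (measurePreserving_piFinSuccAbove (fun _ => κ) 0)
    have hprev := (memLp_two_logPart hom hqm hq hqB hlaw hS hRS hSfin n).comp_measurePreserving
      ((MeasurePreserving.id π).prod hdrop)
    have hinc : MemLp (fun x : Θ × (Fin (n + 1) → V) => logPart π q (fun j => o x.1 (x.2 j)) -
        (logPart π q (fun j => o x.1 (x.2 ((0 : Fin (n + 1)).succAbove j))) + Real.log B)) 2
        (π.prod (Measure.pi fun _ => κ)) := by
      have hmm : Measurable fun x : Θ × (Fin (n + 1) → V) =>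
          logPart π q (fun j => o x.1 (x.2 j)) -
            (logPart π q (fun j => o x.1 (x.2 ((0 : Fin (n + 1)).succAbove j))) + Real.log B) :=
        (hm _).sub (((hm n).comp (measurable_fst.prodMk
          (hdrop.measurable.comp measurable_snd))).add_const _)
      rw [memLp_two_iff_integrable_sq hmm.aestronglyMeasurable]
      refine ⟨(hmm.pow_const 2).aestronglyMeasurable, ?_⟩
      rw [hasFiniteIntegral_iff_ofReal (ae_of_all _ fun _ => sq_nonneg _),
        lintegral_prod _ (hmm.pow_const 2).ennreal_ofReal.aemeasurable]
      exact (lintegral_sq_logPart_sub_le hom hqm hq hqB hlaw hS hRS n 0).trans_lt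
        (ENNReal.mul_lt_top (by simp) (lt_top_iff_ne_top.2 hSfin))
    refine (hinc.add (hprev.add (memLp_const (Real.log B)))).ae_eq (ae_of_all _ fun x => ?_)
    simp [Prod.map]

/-- The variance of the log-partition function, conditionally on the signal, grows at most
linearly with the number of observations. -/
theorem lintegral_sq_logPart_sub_mean_le {π : Measure Θ} [IsProbabilityMeasure π] {κ : Measure V}
    [IsProbabilityMeasure κ] {lam : Measure U} [SigmaFinite lam] {o : Θ → V → U} {q : Θ → U → ℝ}
    {B : ℝ} (hom : Measurable (Function.uncurry o)) (hqm : Measurable (Function.uncurry q))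
    (hq : ∀ θ u, 0 < q θ u) (hqB : ∀ θ u, q θ u ≤ B)
    (hlaw : ∀ θ, κ.map (o θ) = lam.withDensity fun u => ENNReal.ofReal (q θ u))
    {S : Θ → ENNReal} (hS : Measurable S)
    (hRS : ∀ θ' θ, ∫⁻ v, ENNReal.ofReal ((Real.log B - Real.log (q θ (o θ' v))) ^ 2) ∂κ ≤
      S θ' + S θ) (hSfin : ∫⁻ θ, S θ ∂π ≠ ⊤) (n : ℕ) :
    ∫⁻ θ, ∫⁻ v, ENNReal.ofReal ((logPart π q (fun j => o θ (v j)) -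
        ∫ v', logPart π q (fun j => o θ (v' j)) ∂(Measure.pi fun _ : Fin n => κ)) ^ 2)
      ∂(Measure.pi fun _ : Fin n => κ) ∂π ≤ n * (2 * ∫⁻ θ, S θ ∂π) := by
  cases n with
  | zero => simp [logPart]
  | succ m =>
  have hmem := fun k => memLp_two_logPart hom hqm hq hqB hlaw hS hRS hSfin k
  have hdrop : ∀ i : Fin (m + 1), MeasurePreserving
      (fun v : Fin (m + 1) → V => fun j => v (i.succAbove j))
      (Measure.pi fun _ => κ) (Measure.pi fun _ => κ) := fun i =>
    measurePreserving_snd.comp (measurePreserving_piFinSuccAbove (fun _ => κ) i)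
  have hm : ∀ k, Measurable fun x : Θ × (Fin k → V) => logPart π q fun j => o x.1 (x.2 j) :=
    fun k => (measurable_logPart hqm k).comp (measurable_pi_lambda _ fun j =>
      hom.comp (measurable_fst.prodMk ((measurable_pi_apply j).comp measurable_snd)))
  calc _ ≤ ∫⁻ θ, ∑ i : Fin (m + 1), ∫⁻ v, ENNReal.ofReal ((logPart π q (fun j => o θ (v j)) -
        (logPart π q (fun j => o θ (v (i.succAbove j))) + Real.log B)) ^ 2)
      ∂(Measure.pi fun _ : Fin (m + 1) => κ) ∂π := by
        refine lintegral_mono_ae ?_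
        filter_upwards [memLp_two_section_ae (hmem (m + 1)), memLp_two_section_ae (hmem m)]
          with θ h1 h2
        have hg : ∀ i : Fin (m + 1), MemLp (fun v : Fin (m + 1) → V =>
            logPart π q (fun j => o θ (v (i.succAbove j))) + Real.log B) 2
            (Measure.pi fun _ => κ) := fun i =>
          (h2.comp_measurePreserving (hdrop i)).add (memLp_const _)
        have hES := variance_pi_le_sum κ (m + 1) _ _ h1 hg fun i a e => by
          simp
        rw [variance_eq_integral h1.aestronglyMeasurable.aemeasurable] at hES
        refine (ofReal_integral_eq_lintegral_ofReal (h1.sub (memLp_const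
          (∫ v', logPart π q (fun j => o θ (v' j)) ∂(Measure.pi fun _ : Fin (m + 1) => κ)))).integrable_sq
          (ae_of_all _ fun _ => sq_nonneg _)).symm.le.trans ?_
        refine (ENNReal.ofReal_le_ofReal hES).trans ?_
        rw [ENNReal.ofReal_sum_of_nonneg fun i _ => integral_nonneg fun _ => sq_nonneg _]
        refine Finset.sum_le_sum fun i _ => ?_
        exact (ofReal_integral_eq_lintegral_ofReal
          (h1.sub (hg i)).integrable_sq (ae_of_all _ fun _ => sq_nonneg _)).le
    _ = ∑ i : Fin (m + 1), ∫⁻ θ, ∫⁻ v, ENNReal.ofReal ((logPart π q (fun j => o θ (v j)) -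
        (logPart π q (fun j => o θ (v (i.succAbove j))) + Real.log B)) ^ 2)
      ∂(Measure.pi fun _ : Fin (m + 1) => κ) ∂π := by
        refine lintegral_finsetSum _ fun i _ => ?_
        have hmm : Measurable fun x : Θ × (Fin (m + 1) → V) =>
            logPart π q (fun j => o x.1 (x.2 j)) -
              (logPart π q (fun j => o x.1 (x.2 (i.succAbove j))) + Real.log B) :=
          (hm _).sub (((hm m).comp (measurable_fst.prodMk
            ((hdrop i).measurable.comp measurable_snd))).add_const _)
        exact (ENNReal.measurable_ofReal.comp (hmm.pow_const 2)).lintegral_prod_right'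
    _ ≤ ∑ i : Fin (m + 1), 2 * ∫⁻ θ, S θ ∂π := Finset.sum_le_sum fun i _ =>
        lintegral_sq_logPart_sub_le hom hqm hq hqB hlaw hS hRS m i
    _ = _ := by simp

end LeaveOneOut

lemma measurable_extW {d : ℕ → ℕ} {L : ℕ} (ℓ : ℕ) :
    Measurable fun W : Wspace d L => extW W ℓ := by
  unfold extW
  split_ifs with h
  · exact measurable_pi_apply _
  · exact measurable_const

lemma measurable_feat {φ : ℝ → ℝ} (hφ : Measurable φ) (d : ℕ → ℕ) (L : ℕ) : ∀ ℓ,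
    Measurable fun x : Wspace d L × (Fin (d 0) → ℝ) => feat φ d (extW x.1) x.2 ℓ
  | 0 => measurable_snd
  | ℓ + 1 => by
    refine measurable_pi_lambda _ fun i => hφ.comp (Measurable.div_const ?_ _)
    refine Finset.measurable_sum _ fun j _ => Measurable.mul ?_ ?_
    · exact (measurable_pi_apply j).comp ((measurable_pi_apply i).comp
        ((measurable_extW ℓ).comp measurable_fst))
    · exact (measurable_pi_apply j).comp (measurable_feat hφ d L ℓ)

lemma measurable_readout {φ : ℝ → ℝ} (hφ : Measurable φ) (d : ℕ → ℕ) (L ℓ : ℕ) :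
    Measurable fun x : Wspace d L × (Fin (d ℓ) → ℝ) × (Fin (d 0) → ℝ) =>
      (∑ i, x.2.1 i * feat φ d (extW x.1) x.2.2 ℓ i) / Real.sqrt (d ℓ : ℝ) := by
  refine Measurable.div_const (Finset.measurable_sum _ fun i _ => Measurable.mul ?_ ?_) _
  · exact (measurable_pi_apply i).comp (measurable_fst.comp measurable_snd)
  · exact (measurable_pi_apply i).comp ((measurable_feat hφ d L ℓ).comp
      (measurable_fst.prodMk (measurable_snd.comp measurable_snd)))

lemma measurable_interpSig {φ : ℝ → ℝ} (hφ : Measurable φ) (d : ℕ → ℕ) (L : ℕ) (t : ℝ) :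
    Measurable fun x : psi3Space d L × (Fin (d 0) → ℝ) × ℝ =>
      interpSig φ d L t x.1.1 x.1.2.1 x.1.2.2 x.2.2 x.2.1 := by
  unfold interpSig netOut
  refine Measurable.add (Measurable.add (Measurable.const_mul ?_ _) (Measurable.const_mul ?_ _))
    (Measurable.const_mul (by fun_prop) _)
  · exact (measurable_readout hφ d L L).comp (f := fun x : psi3Space d L × (Fin (d 0) → ℝ) × ℝ =>
      (x.1.1, x.1.2.1, x.2.1)) (by fun_prop)
  · exact (measurable_readout hφ d L (L - 1)).comp
      (f := fun x : psi3Space d L × (Fin (d 0) → ℝ) × ℝ => (x.1.1, x.1.2.2, x.2.1)) (by fun_prop)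

section Channel

variable {p : ℕ} {PA : Measure (Fin p → ℝ)} [IsProbabilityMeasure PA] {Δ : ℝ}
  {f : ℝ → (Fin p → ℝ) → ℝ}

lemma gaussian_kernel_pos (hΔ : 0 < Δ) (y s : ℝ) :
    0 < Real.exp (-(y - s) ^ 2 / (2 * Δ)) / Real.sqrt (2 * Real.pi * Δ) := by positivity

lemma gaussian_kernel_le (hΔ : 0 < Δ) (y s : ℝ) :
    Real.exp (-(y - s) ^ 2 / (2 * Δ)) / Real.sqrt (2 * Real.pi * Δ) ≤
      1 / Real.sqrt (2 * Real.pi * Δ) := by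
  gcongr
  rw [Real.exp_le_one_iff]
  exact div_nonpos_of_nonpos_of_nonneg (neg_nonpos.2 (sq_nonneg _)) (by positivity)

end Channel

/-- Likelihood of one labelled sample given the signal `(W, a, v)`. -/
def likelihood {p : ℕ} (PA : Measure (Fin p → ℝ)) (Δ : ℝ) (φ : ℝ → ℝ)
    (f : ℝ → (Fin p → ℝ) → ℝ) (d : ℕ → ℕ) (L : ℕ) (t : ℝ) (θ : psi3Space d L)
    (u : (Fin (d 0) → ℝ) × ℝ) : ℝ :=
  ∫ ζ, Pout PA Δ f u.2 (interpSig φ d L t θ.1 θ.2.1 θ.2.2 ζ u.1) ∂stdG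

/-- Labelled sample produced by the teacher signal `θ` from `((X, ζ, Z), A)`. -/
def observation {p : ℕ} (Δ : ℝ) (φ : ℝ → ℝ) (f : ℝ → (Fin p → ℝ) → ℝ) (d : ℕ → ℕ) (L : ℕ)
    (t : ℝ) (θ : psi3Space d L) (v : ((Fin (d 0) → ℝ) × ℝ × ℝ) × (Fin p → ℝ)) :
    (Fin (d 0) → ℝ) × ℝ :=
  (v.1.1, f (interpSig φ d L t θ.1 θ.2.1 θ.2.2 v.1.2.1 v.1.1) v.2 + Real.sqrt Δ * v.1.2.2)

/-- Law of the randomness attached to one sample. -/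
def sampleMeasure (d : ℕ → ℕ) {p : ℕ} (PA : Measure (Fin p → ℝ)) [IsProbabilityMeasure PA] :
    Measure (((Fin (d 0) → ℝ) × ℝ × ℝ) × (Fin p → ℝ)) :=
  ((stdGPi (d 0)).prod (stdG.prod stdG)).prod PA

instance (d : ℕ → ℕ) {p : ℕ} (PA : Measure (Fin p → ℝ)) [IsProbabilityMeasure PA] :
    IsProbabilityMeasure (sampleMeasure d PA) := by unfold sampleMeasure; infer_instance

section Likelihood

variable {p : ℕ} {PA : Measure (Fin p → ℝ)} [IsProbabilityMeasure PA] {Δ : ℝ} {φ : ℝ → ℝ}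
  {f : ℝ → (Fin p → ℝ) → ℝ}

/-- The likelihood as a single average over `(ζ, A)` of a Gaussian kernel. -/
lemma likelihood_eq_integral_prod (hΔ : 0 < Δ) (hφ : Measurable φ)
    (hf : Measurable (Function.uncurry f)) (d : ℕ → ℕ) (L : ℕ) (t : ℝ) (θ : psi3Space d L)
    (u : (Fin (d 0) → ℝ) × ℝ) :
    likelihood PA Δ φ f d L t θ u = ∫ x : ℝ × (Fin p → ℝ),
      Real.exp (-(u.2 - f (interpSig φ d L t θ.1 θ.2.1 θ.2.2 x.1 u.1) x.2) ^ 2 / (2 * Δ)) /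
        Real.sqrt (2 * Real.pi * Δ) ∂(stdG.prod PA) := by
  unfold likelihood Pout
  rw [integral_prod]
  have hs : Measurable fun ζ => interpSig φ d L t θ.1 θ.2.1 θ.2.2 ζ u.1 :=
    (measurable_interpSig hφ d L t).comp (f := fun ζ => (θ, u.1, ζ)) (by fun_prop)
  have hfs : Measurable fun x : ℝ × (Fin p → ℝ) =>
      f (interpSig φ d L t θ.1 θ.2.1 θ.2.2 x.1 u.1) x.2 :=
    hf.comp ((hs.comp measurable_fst).prodMk measurable_snd)
  refine Integrable.of_bound (C := 1 / Real.sqrt (2 * Real.pi * Δ))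
    (Measurable.aestronglyMeasurable (by fun_prop)) (ae_of_all _ fun x => ?_)
  rw [Real.norm_of_nonneg (gaussian_kernel_pos hΔ _ _).le]
  exact gaussian_kernel_le hΔ _ _

lemma measurable_kernel_interpSig (hφ : Measurable φ)
    (hf : Measurable (Function.uncurry f)) (d : ℕ → ℕ) (L : ℕ) (t : ℝ) :
    Measurable fun z : (psi3Space d L × ((Fin (d 0) → ℝ) × ℝ)) × (ℝ × (Fin p → ℝ)) =>
      Real.exp (-(z.1.2.2 - f (interpSig φ d L t z.1.1.1 z.1.1.2.1 z.1.1.2.2 z.2.1 z.1.2.1)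
        z.2.2) ^ 2 / (2 * Δ)) / Real.sqrt (2 * Real.pi * Δ) := by
  have hs : Measurable fun z : (psi3Space d L × ((Fin (d 0) → ℝ) × ℝ)) × (ℝ × (Fin p → ℝ)) =>
      interpSig φ d L t z.1.1.1 z.1.1.2.1 z.1.1.2.2 z.2.1 z.1.2.1 :=
    (measurable_interpSig hφ d L t).comp
      (f := fun z : (psi3Space d L × ((Fin (d 0) → ℝ) × ℝ)) × (ℝ × (Fin p → ℝ)) =>
        (z.1.1, z.1.2.1, z.2.1)) (by fun_prop)
  have hfs : Measurable fun z : (psi3Space d L × ((Fin (d 0) → ℝ) × ℝ)) × (ℝ × (Fin p → ℝ)) =>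
      f (interpSig φ d L t z.1.1.1 z.1.1.2.1 z.1.1.2.2 z.2.1 z.1.2.1) z.2.2 :=
    hf.comp (hs.prodMk (measurable_snd.comp measurable_snd))
  fun_prop

lemma measurable_likelihood (hΔ : 0 < Δ) (hφ : Measurable φ)
    (hf : Measurable (Function.uncurry f)) (d : ℕ → ℕ) (L : ℕ) (t : ℝ) :
    Measurable (Function.uncurry (likelihood PA Δ φ f d L t)) := by
  have : Function.uncurry (likelihood PA Δ φ f d L t) = fun y => ∫ x, _ ∂(stdG.prod PA) :=
    funext fun y => likelihood_eq_integral_prod hΔ hφ hf d L t y.1 y.2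
  rw [this]
  exact (measurable_kernel_interpSig hφ hf d L t).stronglyMeasurable.integral_prod_right.measurable

lemma measurable_observation (hφ : Measurable φ)
    (hf : Measurable (Function.uncurry f)) (d : ℕ → ℕ) (L : ℕ) (t : ℝ) :
    Measurable (Function.uncurry (observation Δ φ f d L t)) := by
  have hs : Measurable fun z : psi3Space d L × (((Fin (d 0) → ℝ) × ℝ × ℝ) × (Fin p → ℝ)) =>
      interpSig φ d L t z.1.1 z.1.2.1 z.1.2.2 z.2.1.2.1 z.2.1.1 :=
    (measurable_interpSig hφ d L t).comp
      (f := fun z : psi3Space d L × (((Fin (d 0) → ℝ) × ℝ × ℝ) × (Fin p → ℝ)) =>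
        (z.1, z.2.1.1, z.2.1.2.1)) (by fun_prop)
  have hfs : Measurable fun z : psi3Space d L × (((Fin (d 0) → ℝ) × ℝ × ℝ) × (Fin p → ℝ)) =>
      f (interpSig φ d L t z.1.1 z.1.2.1 z.1.2.2 z.2.1.2.1 z.2.1.1) z.2.2 :=
    hf.comp (hs.prodMk (by fun_prop))
  unfold observation Function.uncurry
  fun_prop

lemma likelihood_pos (hΔ : 0 < Δ) (hφ : Measurable φ)
    (hf : Measurable (Function.uncurry f)) (d : ℕ → ℕ) (L : ℕ) (t : ℝ) (θ : psi3Space d L)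
    (u : (Fin (d 0) → ℝ) × ℝ) : 0 < likelihood PA Δ φ f d L t θ u := by
  rw [likelihood_eq_integral_prod hΔ hφ hf]
  have hm := (measurable_kernel_interpSig (Δ := Δ) hφ hf d L t).comp
    (measurable_prodMk_left (x := (θ, u)))
  have hi := Integrable.of_bound (μ := stdG.prod PA) (C := 1 / Real.sqrt (2 * Real.pi * Δ))
    hm.aestronglyMeasurable (ae_of_all _ fun x => by
      rw [Function.comp, Real.norm_of_nonneg (gaussian_kernel_pos hΔ _ _).le]
      exact gaussian_kernel_le hΔ _ _)
  refine (integral_pos_iff_support_of_nonneg (fun x => (gaussian_kernel_pos hΔ _ _).le) hi).2 ?_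
  rw [Set.eq_univ_of_forall fun x => Function.mem_support.2 (gaussian_kernel_pos hΔ _ _).ne']
  simp

lemma likelihood_le (hΔ : 0 < Δ) (hφ : Measurable φ)
    (hf : Measurable (Function.uncurry f)) (d : ℕ → ℕ) (L : ℕ) (t : ℝ) (θ : psi3Space d L)
    (u : (Fin (d 0) → ℝ) × ℝ) :
    likelihood PA Δ φ f d L t θ u ≤ 1 / Real.sqrt (2 * Real.pi * Δ) := by
  rw [likelihood_eq_integral_prod hΔ hφ hf]
  refine (integral_mono_of_nonneg (ae_of_all _ fun x => (gaussian_kernel_pos hΔ _ _).le)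
    (integrable_const _) (ae_of_all _ fun x => gaussian_kernel_le hΔ _ _)).trans ?_
  simp

end Likelihood

lemma lintegral_stdG_affine {Δ : ℝ} (hΔ : 0 < Δ) (c : ℝ) {g : ℝ → ENNReal} (hg : Measurable g) :
    ∫⁻ z, g (c + Real.sqrt Δ * z) ∂stdG =
      ∫⁻ y, ENNReal.ofReal (Real.exp (-(y - c) ^ 2 / (2 * Δ)) / Real.sqrt (2 * Real.pi * Δ)) *
        g y := by
  have hmap : stdG.map (fun z => c + Real.sqrt Δ * z) = gaussianReal c Δ.toNNReal := by
    have h1 : stdG.map (fun z => Real.sqrt Δ * z) = gaussianReal 0 Δ.toNNReal := by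
      unfold stdG
      rw [gaussianReal_map_const_mul]
      congr 1
      · simp
      · ext; simp [Real.sq_sqrt hΔ.le, hΔ.le]
    have h2 : stdG.map (fun z => c + Real.sqrt Δ * z) =
        (stdG.map (fun z => Real.sqrt Δ * z)).map (fun y => c + y) := by
      rw [Measure.map_map (by fun_prop) (by fun_prop)]
      rfl
    rw [h2, h1, gaussianReal_map_const_add]
    simp
  rw [← lintegral_map (f := g) hg (by fun_prop), hmap, gaussianReal_of_var_ne_zero]
  swap
  · exact (Real.toNNReal_pos.2 hΔ).ne'
  rw [lintegral_withDensity_eq_lintegral_mul _ (measurable_gaussianPDF _ _) hg]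
  refine lintegral_congr fun y => ?_
  rw [Pi.mul_apply, gaussianPDF, gaussianPDFReal, Real.coe_toNNReal _ hΔ.le, mul_comm, ← div_eq_inv_mul,
    mul_comm]

lemma add_add_pow_four_le (a b c : ℝ) :
    (a + b + c) ^ 4 ≤ 27 * (a ^ 4 + b ^ 4 + c ^ 4) := by
  have h : (a + b + c) ^ 2 ≤ 3 * (a ^ 2 + b ^ 2 + c ^ 2) := by
    nlinarith [sq_nonneg (a - b), sq_nonneg (a - c), sq_nonneg (b - c)]
  have h' := pow_le_pow_left₀ (sq_nonneg _) h 2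
  nlinarith [sq_nonneg (a ^ 2 - b ^ 2), sq_nonneg (a ^ 2 - c ^ 2), sq_nonneg (b ^ 2 - c ^ 2)]

section Likelihood

variable {p : ℕ} {PA : Measure (Fin p → ℝ)} [IsProbabilityMeasure PA] {Δ : ℝ} {φ : ℝ → ℝ}
  {f : ℝ → (Fin p → ℝ) → ℝ}

lemma ofReal_likelihood (hΔ : 0 < Δ) (hφ : Measurable φ)
    (hf : Measurable (Function.uncurry f)) (d : ℕ → ℕ) (L : ℕ) (t : ℝ) (θ : psi3Space d L)
    (u : (Fin (d 0) → ℝ) × ℝ) :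
    ENNReal.ofReal (likelihood PA Δ φ f d L t θ u) = ∫⁻ x : ℝ × (Fin p → ℝ), ENNReal.ofReal
      (Real.exp (-(u.2 - f (interpSig φ d L t θ.1 θ.2.1 θ.2.2 x.1 u.1) x.2) ^ 2 / (2 * Δ)) /
        Real.sqrt (2 * Real.pi * Δ)) ∂(stdG.prod PA) := by
  rw [likelihood_eq_integral_prod hΔ hφ hf]
  refine ofReal_integral_eq_lintegral_ofReal ?_
    (ae_of_all _ fun x => (gaussian_kernel_pos hΔ _ _).le)
  refine Integrable.of_bound (C := 1 / Real.sqrt (2 * Real.pi * Δ))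
    ((measurable_kernel_interpSig (Δ := Δ) hφ hf d L t).comp
      (measurable_prodMk_left (x := (θ, u)))).aestronglyMeasurable (ae_of_all _ fun x => ?_)
  rw [Real.norm_of_nonneg (gaussian_kernel_pos hΔ _ _).le]
  exact gaussian_kernel_le hΔ _ _

/-- The likelihood is the density of the law of an observation. -/
lemma map_observation (hΔ : 0 < Δ) (hφ : Measurable φ)
    (hf : Measurable (Function.uncurry f)) (d : ℕ → ℕ) (L : ℕ) (t : ℝ) (θ : psi3Space d L) :
    (sampleMeasure d PA).map (observation Δ φ f d L t θ) =
      ((stdGPi (d 0)).prod volume).withDensity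
        fun u => ENNReal.ofReal (likelihood PA Δ φ f d L t θ u) := by
  refine Measure.ext_of_lintegral _ fun g hg => ?_
  have hom : Measurable (observation Δ φ f d L t θ) :=
    (measurable_observation hφ hf d L t).of_uncurry_left
  have hqm : Measurable (likelihood PA Δ φ f d L t θ) :=
    (measurable_likelihood hΔ hφ hf d L t).of_uncurry_left
  have hgo : Measurable fun v => g (observation Δ φ f d L t θ v) := hg.comp hom
  rw [lintegral_map hg hom,
    lintegral_withDensity_eq_lintegral_mul _ hqm.ennreal_ofReal hg,
    lintegral_prod _ (hqm.ennreal_ofReal.mul hg).aemeasurable]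
  unfold sampleMeasure
  have hA : Measurable fun z : (Fin (d 0) → ℝ) × ℝ × ℝ =>
      ∫⁻ A, g (observation Δ φ f d L t θ (z, A)) ∂PA := hgo.lintegral_prod_right'
  rw [lintegral_prod _ hgo.aemeasurable, lintegral_prod _ hA.aemeasurable]
  refine lintegral_congr fun x => ?_
  have hAx : Measurable fun y : ℝ × ℝ => ∫⁻ A, g (observation Δ φ f d L t θ ((x, y), A)) ∂PA :=
    hA.comp measurable_prodMk_left
  have hgx : Measurable fun y => g (x, y) := hg.comp measurable_prodMk_left
  rw [lintegral_prod _ hAx.aemeasurable]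
  have hk : Measurable fun z : ℝ × (ℝ × (Fin p → ℝ)) => ENNReal.ofReal
      (Real.exp (-(z.1 - f (interpSig φ d L t θ.1 θ.2.1 θ.2.2 z.2.1 x) z.2.2) ^ 2 / (2 * Δ)) /
        Real.sqrt (2 * Real.pi * Δ)) * g (x, z.1) :=
    ((measurable_kernel_interpSig (Δ := Δ) hφ hf d L t).comp
      (f := fun z : ℝ × (ℝ × (Fin p → ℝ)) => ((θ, (x, z.1)), z.2))
      (by fun_prop)).ennreal_ofReal.mul (hgx.comp measurable_fst)
  calc _ = ∫⁻ ζ, ∫⁻ A, ∫⁻ z, g (observation Δ φ f d L t θ ((x, (ζ, z)), A)) ∂stdG ∂PA ∂stdG := by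
        refine lintegral_congr fun ζ => lintegral_lintegral_swap ?_
        exact (hgo.comp (f := fun w : ℝ × (Fin p → ℝ) => ((x, (ζ, w.1)), w.2))
          (by fun_prop)).aemeasurable
    _ = ∫⁻ ζ, ∫⁻ A, ∫⁻ y, ENNReal.ofReal
          (Real.exp (-(y - f (interpSig φ d L t θ.1 θ.2.1 θ.2.2 ζ x) A) ^ 2 / (2 * Δ)) /
          Real.sqrt (2 * Real.pi * Δ)) * g (x, y) ∂volume ∂PA ∂stdG :=
        lintegral_congr fun ζ => lintegral_congr fun A => lintegral_stdG_affine hΔ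
          (f (interpSig φ d L t θ.1 θ.2.1 θ.2.2 ζ x) A) hgx
    _ = ∫⁻ w : ℝ × (Fin p → ℝ), ∫⁻ y, ENNReal.ofReal
          (Real.exp (-(y - f (interpSig φ d L t θ.1 θ.2.1 θ.2.2 w.1 x) w.2) ^ 2 / (2 * Δ)) /
          Real.sqrt (2 * Real.pi * Δ)) * g (x, y) ∂volume ∂(stdG.prod PA) := by
        exact (lintegral_prod _ (hk.comp measurable_swap).lintegral_prod_right'.aemeasurable).symm
    _ = _ := by
        rw [lintegral_lintegral_swap]
        swap
        · exact (hk.comp measurable_swap).aemeasurable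
        refine lintegral_congr fun y => ?_
        rw [Pi.mul_apply, ofReal_likelihood hΔ hφ hf, ← lintegral_mul_const]
        exact ((measurable_kernel_interpSig (Δ := Δ) hφ hf d L t).comp
          (measurable_prodMk_left (x := (θ, (x, y))))).ennreal_ofReal

lemma measurable_interpSig_four (hφ : Measurable φ) (d : ℕ → ℕ) (L : ℕ) (t : ℝ)
    (θ : psi3Space d L) : Measurable (Function.uncurry fun (x : Fin (d 0) → ℝ) (ζ : ℝ) =>
      ENNReal.ofReal (interpSig φ d L t θ.1 θ.2.1 θ.2.2 ζ x ^ 4)) :=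
  (((measurable_interpSig hφ d L t).comp
    (measurable_prodMk_left (x := θ))).pow_const 4).ennreal_ofReal

/-- Fourth moment of the teacher pre-activation, conditionally on the signal. -/
def signalMoment (φ : ℝ → ℝ) (d : ℕ → ℕ) (L : ℕ) (t : ℝ) (θ : psi3Space d L) : ENNReal :=
  ∫⁻ x, ∫⁻ ζ, ENNReal.ofReal (interpSig φ d L t θ.1 θ.2.1 θ.2.2 ζ x ^ 4) ∂stdG ∂(stdGPi (d 0))

lemma measurable_signalMoment (hφ : Measurable φ) (d : ℕ → ℕ) (L : ℕ) (t : ℝ) :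
    Measurable (signalMoment φ d L t) := by
  have h : Measurable fun z : (psi3Space d L × (Fin (d 0) → ℝ)) × ℝ =>
      ENNReal.ofReal (interpSig φ d L t z.1.1.1 z.1.1.2.1 z.1.1.2.2 z.2 z.1.2 ^ 4) :=
    (((measurable_interpSig hφ d L t).comp
      (f := fun z : (psi3Space d L × (Fin (d 0) → ℝ)) × ℝ => (z.1.1, z.1.2, z.2))
      (by fun_prop)).pow_const 4).ennreal_ofReal
  exact (h.lintegral_prod_right').lintegral_prod_right'

/-- Fourth moment of a standard Gaussian. -/
def gaussFour : ENNReal := ∫⁻ z, ENNReal.ofReal (z ^ 4) ∂stdG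

lemma gaussFour_lt_top : gaussFour < ⊤ := by
  have h : MemLp id 4 stdG := memLp_id_gaussianReal 4
  have := h.integrable_norm_pow (by norm_num)
  have h2 := (hasFiniteIntegral_iff_ofReal (ae_of_all _ fun x => by positivity)).1 this.2
  refine lt_of_le_of_lt (lintegral_mono fun z => le_of_eq ?_) h2
  congr 1
  simp [Even.pow_abs (by decide : Even 4)]

lemma lintegral_sampleMeasure_split (d : ℕ → ℕ) (PA : Measure (Fin p → ℝ))
    [IsProbabilityMeasure PA] {g' g : (Fin (d 0) → ℝ) → ℝ → ENNReal}
    (hg' : Measurable (Function.uncurry g')) (hg : Measurable (Function.uncurry g))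
    (c₁ c₂ : ENNReal) :
    ∫⁻ v, (c₁ * g' v.1.1 v.1.2.1 + c₂ * ENNReal.ofReal (v.1.2.2 ^ 4)) +
        c₁ * ∫⁻ ζ, g v.1.1 ζ ∂stdG ∂(sampleMeasure d PA) =
      (c₁ * ∫⁻ x, ∫⁻ ζ, g' x ζ ∂stdG ∂(stdGPi (d 0)) + c₂ * gaussFour) +
        c₁ * ∫⁻ x, ∫⁻ ζ, g x ζ ∂stdG ∂(stdGPi (d 0)) := by
  have hX : Measurable fun x => ∫⁻ ζ, g x ζ ∂stdG := hg.lintegral_prod_right'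
  have hz : Measurable fun z : ℝ => ENNReal.ofReal (z ^ 4) := by fun_prop
  have hp1 : MeasurePreserving (fun v : ((Fin (d 0) → ℝ) × ℝ × ℝ) × (Fin p → ℝ) => v.1.1)
      (sampleMeasure d PA) (stdGPi (d 0)) := measurePreserving_fst.comp measurePreserving_fst
  have hpz : MeasurePreserving (fun v : ((Fin (d 0) → ℝ) × ℝ × ℝ) × (Fin p → ℝ) => v.1.2.2)
      (sampleMeasure d PA) stdG :=
    (measurePreserving_snd.comp measurePreserving_snd).comp measurePreserving_fst
  have hp2 : MeasurePreserving (fun v : ((Fin (d 0) → ℝ) × ℝ × ℝ) × (Fin p → ℝ) =>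
      (v.1.1, v.1.2.1)) (sampleMeasure d PA) ((stdGPi (d 0)).prod stdG) :=
    ((MeasurePreserving.id _).prod measurePreserving_fst).comp measurePreserving_fst
  have hms : Measurable fun v : ((Fin (d 0) → ℝ) × ℝ × ℝ) × (Fin p → ℝ) => g' v.1.1 v.1.2.1 :=
    hg'.comp hp2.measurable
  have hmz : Measurable fun v : ((Fin (d 0) → ℝ) × ℝ × ℝ) × (Fin p → ℝ) =>
      ENNReal.ofReal (v.1.2.2 ^ 4) := by fun_prop
  have hmX : Measurable fun v : ((Fin (d 0) → ℝ) × ℝ × ℝ) × (Fin p → ℝ) =>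
      ∫⁻ ζ, g v.1.1 ζ ∂stdG := hX.comp hp1.measurable
  have e1 : ∫⁻ v, g' v.1.1 v.1.2.1 ∂(sampleMeasure d PA) =
      ∫⁻ x, ∫⁻ ζ, g' x ζ ∂stdG ∂(stdGPi (d 0)) :=
    (hp2.lintegral_comp hg').trans (lintegral_prod _ hg'.aemeasurable)
  have e2 : ∫⁻ v, ENNReal.ofReal (v.1.2.2 ^ 4) ∂(sampleMeasure d PA) = gaussFour :=
    hpz.lintegral_comp hz
  have e3 : ∫⁻ v, ∫⁻ ζ, g v.1.1 ζ ∂stdG ∂(sampleMeasure d PA) =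
      ∫⁻ x, ∫⁻ ζ, g x ζ ∂stdG ∂(stdGPi (d 0)) := hp1.lintegral_comp hX
  rw [lintegral_add_right _ (hmX.const_mul _),
    lintegral_add_left (hms.const_mul _), lintegral_const_mul _ hms, lintegral_const_mul _ hmz,
    lintegral_const_mul _ hmX, e1, e2, e3]

lemma sq_log_likelihood_le (hΔ : 0 < Δ) (hφ : Measurable φ)
    (hf : Measurable (Function.uncurry f)) (d : ℕ → ℕ) (L : ℕ) (t : ℝ) (θ : psi3Space d L)
    (u : (Fin (d 0) → ℝ) × ℝ) :
    ENNReal.ofReal ((Real.log (1 / Real.sqrt (2 * Real.pi * Δ)) -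
        Real.log (likelihood PA Δ φ f d L t θ u)) ^ 2) ≤
      ∫⁻ x : ℝ × (Fin p → ℝ), ENNReal.ofReal
        ((u.2 - f (interpSig φ d L t θ.1 θ.2.1 θ.2.2 x.1 u.1) x.2) ^ 4 / (4 * Δ ^ 2))
        ∂(stdG.prod PA) := by
  have hkm := (measurable_kernel_interpSig (Δ := Δ) hφ hf d L t).comp
    (measurable_prodMk_left (x := (θ, u)))
  have hJ := sq_log_weighted_mean_le (π := stdG.prod PA) (w := fun _ => 1)
    measurable_const (integrable_const _) (fun _ => one_pos) hkm
    (fun x => gaussian_kernel_pos hΔ _ _) (fun x => gaussian_kernel_le hΔ _ _)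
  simp only [one_mul, integral_const, probReal_univ, smul_eq_mul, Real.log_one, sub_zero,
    ENNReal.ofReal_one, mul_one, Function.comp_def] at hJ
  rw [likelihood_eq_integral_prod hΔ hφ hf, sub_sq_comm]
  refine hJ.trans (lintegral_mono fun x => le_of_eq ?_)
  have hB : (0 : ℝ) < Real.sqrt (2 * Real.pi * Δ) := by positivity
  rw [Real.log_div (Real.exp_pos _).ne' hB.ne', Real.log_div one_ne_zero hB.ne',
    Real.log_exp, Real.log_one]
  congr 1
  field_simp
  ring

lemma lintegral_sq_log_likelihood_le (hΔ : 0 < Δ) (hφ : Measurable φ)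
    (hf : Measurable (Function.uncurry f)) {K : ℝ} (hK : ∀ x A, |f x A| ≤ K * |x|)
    (d : ℕ → ℕ) (L : ℕ) (t : ℝ) (θ' θ : psi3Space d L) :
    ∫⁻ v, ENNReal.ofReal ((Real.log (1 / Real.sqrt (2 * Real.pi * Δ)) -
        Real.log (likelihood PA Δ φ f d L t θ (observation Δ φ f d L t θ' v))) ^ 2)
      ∂(sampleMeasure d PA) ≤
    (ENNReal.ofReal (27 * K ^ 4 / (4 * Δ ^ 2)) * signalMoment φ d L t θ' +
        ENNReal.ofReal (27 / 4) * gaussFour) +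
      (ENNReal.ofReal (27 * K ^ 4 / (4 * Δ ^ 2)) * signalMoment φ d L t θ +
        ENNReal.ofReal (27 / 4) * gaussFour) := by
  set c₁ := ENNReal.ofReal (27 * K ^ 4 / (4 * Δ ^ 2))
  set c₂ := ENNReal.ofReal (27 / 4)
  have hsig := measurable_interpSig_four hφ d L t
  have hpt : ∀ v : ((Fin (d 0) → ℝ) × ℝ × ℝ) × (Fin p → ℝ), ENNReal.ofReal
      ((Real.log (1 / Real.sqrt (2 * Real.pi * Δ)) -
        Real.log (likelihood PA Δ φ f d L t θ (observation Δ φ f d L t θ' v))) ^ 2) ≤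
      (c₁ * ENNReal.ofReal (interpSig φ d L t θ'.1 θ'.2.1 θ'.2.2 v.1.2.1 v.1.1 ^ 4) +
        c₂ * ENNReal.ofReal (v.1.2.2 ^ 4)) +
      c₁ * ∫⁻ ζ, ENNReal.ofReal (interpSig φ d L t θ.1 θ.2.1 θ.2.2 ζ v.1.1 ^ 4) ∂stdG := by
    intro v
    set u := observation Δ φ f d L t θ' v with hu
    refine (sq_log_likelihood_le hΔ hφ hf d L t θ u).trans ?_
    have hsl := (hsig θ).of_uncurry_left (x := v.1.1)
    calc _ ≤ ∫⁻ x : ℝ × (Fin p → ℝ), (c₁ * ENNReal.ofReal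
            (interpSig φ d L t θ'.1 θ'.2.1 θ'.2.2 v.1.2.1 v.1.1 ^ 4) +
            c₂ * ENNReal.ofReal (v.1.2.2 ^ 4)) +
          c₁ * ENNReal.ofReal (interpSig φ d L t θ.1 θ.2.1 θ.2.2 x.1 v.1.1 ^ 4)
          ∂(stdG.prod PA) := by
          refine lintegral_mono fun x => ?_
          rw [← ENNReal.ofReal_mul (by positivity), ← ENNReal.ofReal_mul (by positivity),
            ← ENNReal.ofReal_mul (by positivity), ← ENNReal.ofReal_add (by positivity)
            (by positivity), ← ENNReal.ofReal_add (by positivity) (by positivity)]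
          refine ENNReal.ofReal_le_ofReal ?_
          have h1 : u.1 = v.1.1 := rfl
          have h2 : u.2 = f (interpSig φ d L t θ'.1 θ'.2.1 θ'.2.2 v.1.2.1 v.1.1) v.2 +
            Real.sqrt Δ * v.1.2.2 := rfl
          rw [h1, h2]
          set s' := interpSig φ d L t θ'.1 θ'.2.1 θ'.2.2 v.1.2.1 v.1.1
          set s := interpSig φ d L t θ.1 θ.2.1 θ.2.2 x.1 v.1.1
          have four : ∀ r A, f r A ^ 4 ≤ K ^ 4 * r ^ 4 := fun r A => by
            have := pow_le_pow_left₀ (abs_nonneg _) (hK r A) 4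
            rwa [mul_pow, Even.pow_abs (by decide), Even.pow_abs (by decide)] at this
          have hD : (Real.sqrt Δ * v.1.2.2) ^ 4 = Δ ^ 2 * v.1.2.2 ^ 4 := by
            rw [mul_pow, show Real.sqrt Δ ^ 4 = (Real.sqrt Δ ^ 2) ^ 2 by ring, Real.sq_sqrt hΔ.le]
          have h3 := add_add_pow_four_le (f s' v.2) (Real.sqrt Δ * v.1.2.2) (-f s x.2)
          rw [hD, ← sub_eq_add_neg, Even.neg_pow (by decide)] at h3
          have h4 : (f s' v.2 + Real.sqrt Δ * v.1.2.2 - f s x.2) ^ 4 ≤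
              27 * (K ^ 4 * s' ^ 4 + Δ ^ 2 * v.1.2.2 ^ 4 + K ^ 4 * s ^ 4) :=
            h3.trans (by gcongr <;> exact four _ _)
          calc _ ≤ 27 * (K ^ 4 * s' ^ 4 + Δ ^ 2 * v.1.2.2 ^ 4 + K ^ 4 * s ^ 4) / (4 * Δ ^ 2) := by
                gcongr
            _ = _ := by field_simp
      _ = _ := by
          rw [lintegral_add_left measurable_const, lintegral_const, measure_univ, mul_one]
          congr 1
          exact ((measurePreserving_fst (μ := stdG) (ν := PA)).lintegral_comp
            (hsl.const_mul c₁)).trans (lintegral_const_mul _ hsl)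
  refine (lintegral_mono hpt).trans ((lintegral_sampleMeasure_split d PA (hsig θ') (hsig θ) _ _).le.trans ?_)
  exact add_le_add le_rfl le_self_add

end Likelihood

lemma lintegral_pi_update {ι : Type*} [Fintype ι] [DecidableEq ι] {E : ι → Type*}
    [∀ i, MeasurableSpace (E i)] (μ : ∀ i, Measure (E i)) [∀ i, IsProbabilityMeasure (μ i)]
    (i : ι) {F : (∀ i, E i) → ENNReal} (hF : Measurable F) :
    ∫⁻ x, F x ∂(Measure.pi μ) = ∫⁻ x, ∫⁻ y, F (Function.update x i y) ∂(μ i) ∂(Measure.pi μ) := by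
  have hsing : ∀ x, lmarginal μ {i} F x = ∫⁻ y, F (Function.update x i y) ∂(μ i) := fun x => by
    rw [lmarginal_singleton]
  have hG : Measurable fun x => ∫⁻ y, F (Function.update x i y) ∂(μ i) := by
    simp_rw [← hsing]
    exact hF.lmarginal μ
  refine lintegral_eq_of_lmarginal_eq {i} hF hG (funext fun x => ?_)
  rw [lmarginal_singleton, lmarginal_singleton]
  simp

lemma map_sum_mul_stdGPi : ∀ (k : ℕ) (c : Fin k → ℝ),
    (stdGPi k).map (fun a => ∑ j, a j * c j) = gaussianReal 0 (∑ j, c j ^ 2).toNNReal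
  | 0, c => by simp
  | k + 1, c => by
    have hT := (measurePreserving_piFinSuccAbove (fun _ : Fin (k + 1) => stdG) 0).symm
    have h0 : stdG.map (fun x => x * c 0) = gaussianReal 0 (c 0 ^ 2).toNNReal := by
      unfold stdG
      rw [gaussianReal_map_mul_const]
      congr 1
      · simp
      · ext; simp [sq_nonneg]
    have hsum : (∑ j, c j ^ 2).toNNReal =
        (c 0 ^ 2).toNNReal + (∑ j : Fin k, c j.succ ^ 2).toNNReal := by
      rw [Fin.sum_univ_succ, Real.toNNReal_add (by positivity) (by positivity)]
    have hconv := gaussianReal_conv_gaussianReal (m₁ := 0) (m₂ := 0)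
      (v₁ := (c 0 ^ 2).toNNReal) (v₂ := (∑ j : Fin k, c j.succ ^ 2).toNNReal)
    rw [← h0, ← map_sum_mul_stdGPi k (fun j => c j.succ), Measure.conv, add_zero, ← hsum,
      Measure.map_prod_map _ _ (by fun_prop) (by fun_prop),
      Measure.map_map (by fun_prop) (by fun_prop)] at hconv
    rw [← hconv]
    unfold stdGPi
    rw [← hT.map_eq, Measure.map_map (by fun_prop) (MeasurableEquiv.measurable _)]
    congr 1
    funext x
    simp [MeasurableEquiv.piFinSuccAbove, Fin.insertNthEquiv, Fin.sum_univ_succ]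

lemma lintegral_four_gaussianReal (v : NNReal) :
    ∫⁻ x, ENNReal.ofReal (x ^ 4) ∂(gaussianReal 0 v) =
      ENNReal.ofReal ((v : ℝ) ^ 2) * gaussFour := by
  have h : stdG.map (fun z => Real.sqrt v * z) = gaussianReal 0 v := by
    unfold stdG
    rw [gaussianReal_map_const_mul]
    congr 1
    · simp
    · ext; simp
  rw [← h, lintegral_map (by fun_prop) (by fun_prop), gaussFour,
    ← lintegral_const_mul _ (by fun_prop)]
  refine lintegral_congr fun z => ?_
  rw [← ENNReal.ofReal_mul (by positivity), mul_pow,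
    show Real.sqrt v ^ 4 = (Real.sqrt v ^ 2) ^ 2 by ring, Real.sq_sqrt v.coe_nonneg]

lemma lintegral_four_readout_le {k : ℕ} (hk : 1 ≤ k) (c : Fin k → ℝ) :
    ∫⁻ a, ENNReal.ofReal (((∑ j, a j * c j) / Real.sqrt (k : ℝ)) ^ 4) ∂(stdGPi k) ≤
      gaussFour * ((k : ENNReal)⁻¹ * ∑ j, ENNReal.ofReal (c j ^ 4)) := by
  have hk0 : (0 : ℝ) < k := by exact_mod_cast hk
  have hg : Measurable fun y : ℝ => ENNReal.ofReal ((y / Real.sqrt (k : ℝ)) ^ 4) := by fun_prop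
  have hs : (0 : ℝ) ≤ ∑ j, c j ^ 2 := by positivity
  rw [← lintegral_map (f := fun y : ℝ => ENNReal.ofReal ((y / Real.sqrt (k : ℝ)) ^ 4)) hg
    (by fun_prop), map_sum_mul_stdGPi]
  have hdiv : ∀ y : ℝ, ENNReal.ofReal ((y / Real.sqrt (k : ℝ)) ^ 4) =
      ENNReal.ofReal (((k : ℝ) ^ 2)⁻¹) * ENNReal.ofReal (y ^ 4) := fun y => by
    rw [← ENNReal.ofReal_mul (by positivity), div_pow,
      show Real.sqrt (k : ℝ) ^ 4 = (Real.sqrt (k : ℝ) ^ 2) ^ 2 by ring, Real.sq_sqrt hk0.le,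
      div_eq_inv_mul]
  simp_rw [hdiv]
  rw [lintegral_const_mul _ (by fun_prop), lintegral_four_gaussianReal,
    Real.coe_toNNReal _ hs, ← mul_assoc, mul_comm _ gaussFour, ← ENNReal.ofReal_mul (by positivity),
    ← ENNReal.ofReal_sum_of_nonneg fun j _ => by positivity]
  refine mul_le_mul_right ?_ _
  rw [← ENNReal.ofReal_natCast, ← ENNReal.ofReal_inv_of_pos hk0, ← ENNReal.ofReal_mul (by positivity)]
  refine ENNReal.ofReal_le_ofReal ?_
  have hcs := sq_sum_le_card_mul_sum_sq (s := Finset.univ) (f := fun j => c j ^ 2)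
  simp only [Finset.card_univ, Fintype.card_fin, ← pow_mul] at hcs
  calc ((k : ℝ) ^ 2)⁻¹ * (∑ j, c j ^ 2) ^ 2 ≤ ((k : ℝ) ^ 2)⁻¹ * (k * ∑ j, c j ^ 4) := by gcongr
    _ = _ := by field_simp

lemma feat_congr {φ : ℝ → ℝ} {d : ℕ → ℕ} {W W' : (ℓ : ℕ) → Fin (d (ℓ + 1)) → Fin (d ℓ) → ℝ}
    (x0 : Fin (d 0) → ℝ) : ∀ ℓ, (∀ k < ℓ, W k = W' k) → feat φ d W x0 ℓ = feat φ d W' x0 ℓ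
  | 0, _ => rfl
  | ℓ + 1, h => by
    unfold feat
    rw [h ℓ ℓ.lt_succ_self, feat_congr x0 ℓ fun k hk => h k (hk.trans ℓ.lt_succ_self)]

lemma lintegral_average_le {α : Type*} [MeasurableSpace α] {μ : Measure α} {k : ℕ} (hk : 1 ≤ k)
    {F : Fin k → α → ENNReal} (hF : ∀ j, Measurable (F j)) {c M : ENNReal} (hc : c ≠ ⊤)
    (hM : ∀ j, ∫⁻ x, F j x ∂μ ≤ M) :
    ∫⁻ x, c * ((k : ENNReal)⁻¹ * ∑ j, F j x) ∂μ ≤ c * M := by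
  have hk0 : (k : ENNReal) ≠ 0 := by exact_mod_cast (by omega : k ≠ 0)
  rw [lintegral_const_mul' _ _ hc, lintegral_const_mul' _ _ (by simpa using hk0),
    lintegral_finsetSum _ fun j _ => hF j]
  refine mul_le_mul_right ?_ _
  calc _ ≤ (k : ENNReal)⁻¹ * ∑ _j : Fin k, M := by gcongr with j; exact hM j
    _ = M := by
      rw [Finset.sum_const, Finset.card_univ, Fintype.card_fin, nsmul_eq_mul, ← mul_assoc,
        ENNReal.inv_mul_cancel hk0 (ENNReal.natCast_ne_top _), one_mul]

/-- The average over the neurons of a layer inherits a bound on the moments of each neuron. -/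
lemma lintegral_average_feat_four_le {φ : ℝ → ℝ} (hφ : Measurable φ) {d : ℕ → ℕ} {L ℓ : ℕ}
    (hd : 1 ≤ d ℓ) {M : ENNReal} (hM : ∀ i, ∫⁻ W : Wspace d L, ∫⁻ x,
      ENNReal.ofReal (feat φ d (extW W) x ℓ i ^ 4) ∂(stdGPi (d 0)) ∂(Wmeasure d L) ≤ M) :
    ∫⁻ W : Wspace d L, ∫⁻ x, gaussFour * (((d ℓ : ℕ) : ENNReal)⁻¹ *
      ∑ j, ENNReal.ofReal (feat φ d (extW W) x ℓ j ^ 4)) ∂(stdGPi (d 0)) ∂(Wmeasure d L) ≤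
      gaussFour * M := by
  let F : Fin (d ℓ) → Wspace d L × (Fin (d 0) → ℝ) → ENNReal := fun j y =>
    ENNReal.ofReal (feat φ d (extW y.1) y.2 ℓ j ^ 4)
  have hm : ∀ j, Measurable (F j) := fun j =>
    (((measurable_pi_apply j).comp (measurable_feat hφ d L ℓ)).pow_const 4).ennreal_ofReal
  have hs : Measurable fun y => gaussFour * (((d ℓ : ℕ) : ENNReal)⁻¹ * ∑ j, F j y) :=
    ((Finset.measurable_sum _ fun j _ => hm j).const_mul _).const_mul _
  have h := lintegral_average_le (μ := (Wmeasure d L).prod (stdGPi (d 0))) hd hm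
    gaussFour_lt_top.ne (M := M) fun j => by
      rw [lintegral_prod _ (hm j).aemeasurable]
      exact hM j
  rwa [lintegral_prod _ hs.aemeasurable] at h

/-- The fourth moments of the post-activations are bounded independently of the widths. -/
lemma lintegral_feat_four_le {φ : ℝ → ℝ} (hφ : Measurable φ) {K : ℝ}
    (hK : ∀ x, |φ x| ≤ K * |x|) {d : ℕ → ℕ} {L : ℕ} (hd : ∀ ℓ ≤ L, 1 ≤ d ℓ) :
    ∀ ℓ ≤ L, ∀ i, ∫⁻ W : Wspace d L, ∫⁻ x, ENNReal.ofReal (feat φ d (extW W) x ℓ i ^ 4)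
      ∂(stdGPi (d 0)) ∂(Wmeasure d L) ≤ (ENNReal.ofReal (K ^ 4) * gaussFour) ^ ℓ * gaussFour
  | 0, _, i => by
    have hz : Measurable fun z : ℝ => ENNReal.ofReal (z ^ 4) := by fun_prop
    simp only [feat, lintegral_const, measure_univ, mul_one, pow_zero, one_mul]
    exact ((measurePreserving_eval (fun _ : Fin (d 0) => stdG) i).lintegral_comp hz).le
  | ℓ + 1, hℓ, i => by
    have hlt : ℓ < L := hℓ
    have ih := lintegral_feat_four_le hφ hK hd ℓ hlt.le
    have hfm := fun ℓ => measurable_feat hφ d L ℓ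
    have hpm : Measurable fun y : Wspace d L × (Fin (d 0) → ℝ) => ENNReal.ofReal
        (((∑ j, extW y.1 ℓ i j * feat φ d (extW y.1) y.2 ℓ j) / Real.sqrt (d ℓ : ℝ)) ^ 4) := by
      refine (Measurable.pow_const (Measurable.div_const (Finset.measurable_sum _ fun j _ =>
        Measurable.mul ?_ ((measurable_pi_apply j).comp (hfm ℓ))) _) 4).ennreal_ofReal
      exact (measurable_pi_apply j).comp ((measurable_pi_apply i).comp
        ((measurable_extW ℓ).comp measurable_fst))
    have hext : ∀ (W : Wspace d L) w, extW (Function.update W ⟨ℓ, hlt⟩ w) ℓ = w := fun W w => by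
      simp [extW, hlt]
    have hfeat : ∀ (W : Wspace d L) w x,
        feat φ d (extW (Function.update W ⟨ℓ, hlt⟩ w)) x ℓ = feat φ d (extW W) x ℓ := fun W w x =>
      feat_congr x ℓ fun k hk => by
        unfold extW
        split_ifs with h
        · exact Function.update_of_ne (by simpa using hk.ne) _ _
        · rfl
    have hsec : ∀ W : Wspace d L, Measurable fun x => feat φ d (extW W) x ℓ := fun W =>
      (hfm ℓ).comp (measurable_prodMk_left (x := W))
    calc _ ≤ ENNReal.ofReal (K ^ 4) * ∫⁻ W : Wspace d L, ∫⁻ x, ENNReal.ofReal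
          (((∑ j, extW W ℓ i j * feat φ d (extW W) x ℓ j) / Real.sqrt (d ℓ : ℝ)) ^ 4)
            ∂(stdGPi (d 0)) ∂(Wmeasure d L) := by
          rw [← lintegral_const_mul' _ _ ENNReal.ofReal_ne_top]
          refine lintegral_mono fun W => ?_
          rw [← lintegral_const_mul' _ _ ENNReal.ofReal_ne_top]
          refine lintegral_mono fun x => ?_
          rw [← ENNReal.ofReal_mul (by positivity)]
          refine ENNReal.ofReal_le_ofReal ?_
          have := pow_le_pow_left₀ (abs_nonneg _) (hK
            ((∑ j, extW W ℓ i j * feat φ d (extW W) x ℓ j) / Real.sqrt (d ℓ : ℝ))) 4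
          rwa [mul_pow, Even.pow_abs (by decide), Even.pow_abs (by decide)] at this
      _ = ENNReal.ofReal (K ^ 4) * ∫⁻ W : Wspace d L, ∫⁻ x, ∫⁻ a, ENNReal.ofReal
          (((∑ j, a j * feat φ d (extW W) x ℓ j) / Real.sqrt (d ℓ : ℝ)) ^ 4)
            ∂(stdGPi (d ℓ)) ∂(stdGPi (d 0)) ∂(Wmeasure d L) := by
          congr 1
          unfold Wmeasure
          rw [lintegral_pi_update _ ⟨ℓ, hlt⟩ hpm.lintegral_prod_right']
          refine lintegral_congr fun W => ?_
          simp_rw [hext, hfeat]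
          have hjm : Measurable (Function.uncurry fun (a : Fin (d ℓ) → ℝ) (x : Fin (d 0) → ℝ) =>
              ENNReal.ofReal (((∑ j, a j * feat φ d (extW W) x ℓ j) /
                Real.sqrt (d ℓ : ℝ)) ^ 4)) := by
            refine (Measurable.pow_const (Measurable.div_const (Finset.measurable_sum _ fun j _ =>
              Measurable.mul ((measurable_pi_apply j).comp measurable_fst)
                ((measurable_pi_apply j).comp ((hsec W).comp measurable_snd))) _) 4).ennreal_ofReal
          rw [← lintegral_lintegral_swap hjm.aemeasurable]
          exact (measurePreserving_eval (fun _ : Fin (d (ℓ + 1)) => stdGPi (d ℓ)) i).lintegral_comp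
            hjm.lintegral_prod_right'
      _ ≤ ENNReal.ofReal (K ^ 4) * ∫⁻ W : Wspace d L, ∫⁻ x, gaussFour * (((d ℓ : ℕ) : ENNReal)⁻¹ *
          ∑ j, ENNReal.ofReal (feat φ d (extW W) x ℓ j ^ 4)) ∂(stdGPi (d 0)) ∂(Wmeasure d L) := by
          gcongr with W x
          exact lintegral_four_readout_le (hd ℓ hlt.le) _
      _ ≤ ENNReal.ofReal (K ^ 4) *
          (gaussFour * ((ENNReal.ofReal (K ^ 4) * gaussFour) ^ ℓ * gaussFour)) :=
          mul_le_mul_right (lintegral_average_feat_four_le hφ (hd ℓ hlt.le) ih) _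
      _ = _ := by ring

lemma lintegral_prod_prod_swap {α β γ : Type*} [MeasurableSpace α] [MeasurableSpace β]
    [MeasurableSpace γ] {μ : Measure α} {ν : Measure β} {ξ : Measure γ} [SFinite μ] [SFinite ν]
    [SFinite ξ] {F : α × β × γ → ENNReal} (hF : Measurable F) :
    ∫⁻ y, F y ∂(μ.prod (ν.prod ξ)) = ∫⁻ a, ∫⁻ c, ∫⁻ b, F (a, b, c) ∂ν ∂ξ ∂μ := by
  rw [lintegral_prod _ hF.aemeasurable]
  refine lintegral_congr fun a => ?_
  exact lintegral_prod_symm (fun y => F (a, y)) (hF.comp measurable_prodMk_left).aemeasurable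

lemma lintegral_add_add_marginals {α β γ δ ε : Type*} [MeasurableSpace α] [MeasurableSpace β]
    [MeasurableSpace γ] [MeasurableSpace δ] [MeasurableSpace ε] {μ : Measure α} {ν : Measure β}
    {ξ : Measure γ} {η : Measure δ} {τ : Measure ε} [IsProbabilityMeasure μ]
    [IsProbabilityMeasure ν] [IsProbabilityMeasure ξ] [IsProbabilityMeasure η]
    [IsProbabilityMeasure τ] {F : α × β × δ → ENNReal} {G : α × γ × δ → ENNReal}
    {H : ε → ENNReal} (hF : Measurable F) (hG : Measurable G) (hH : Measurable H)
    (c₁ c₂ c₃ : ENNReal) :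
    ∫⁻ θ : α × β × γ, ∫⁻ x, ∫⁻ z, c₁ * (F (θ.1, θ.2.1, x) + c₂ * G (θ.1, θ.2.2, x) + c₃ * H z)
        ∂τ ∂η ∂(μ.prod (ν.prod ξ)) =
      c₁ * (∫⁻ y, F y ∂(μ.prod (ν.prod η)) + c₂ * ∫⁻ y, G y ∂(μ.prod (ξ.prod η)) +
        c₃ * ∫⁻ z, H z ∂τ) := by
  have hpa : MeasurePreserving (fun y : (α × β × γ) × δ × ε => (y.1.1, y.1.2.1, y.2.1))
      ((μ.prod (ν.prod ξ)).prod (η.prod τ)) (μ.prod (ν.prod η)) :=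
    (measurePreserving_prodAssoc μ ν η).comp
      (MeasurePreserving.prod ((MeasurePreserving.id μ).prod measurePreserving_fst)
        measurePreserving_fst)
  have hpv : MeasurePreserving (fun y : (α × β × γ) × δ × ε => (y.1.1, y.1.2.2, y.2.1))
      ((μ.prod (ν.prod ξ)).prod (η.prod τ)) (μ.prod (ξ.prod η)) :=
    (measurePreserving_prodAssoc μ ξ η).comp
      (MeasurePreserving.prod ((MeasurePreserving.id μ).prod measurePreserving_snd)
        measurePreserving_fst)
  have hpz : MeasurePreserving (fun y : (α × β × γ) × δ × ε => y.2.2)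
      ((μ.prod (ν.prod ξ)).prod (η.prod τ)) τ :=
    measurePreserving_snd.comp measurePreserving_snd
  have h1 : Measurable fun y : (α × β × γ) × δ × ε => F (y.1.1, y.1.2.1, y.2.1) :=
    hF.comp hpa.measurable
  have h2 : Measurable fun y : (α × β × γ) × δ × ε => G (y.1.1, y.1.2.2, y.2.1) :=
    hG.comp hpv.measurable
  have h3 : Measurable fun y : (α × β × γ) × δ × ε => H y.2.2 := hH.comp hpz.measurable
  have hs : Measurable fun y : (α × β × γ) × δ × ε =>
      F (y.1.1, y.1.2.1, y.2.1) + c₂ * G (y.1.1, y.1.2.2, y.2.1) + c₃ * H y.2.2 :=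
    (h1.add (h2.const_mul _)).add (h3.const_mul _)
  have hm := hs.const_mul c₁
  have hms : ∀ θ : α × β × γ, Measurable fun y : δ × ε =>
      c₁ * (F (θ.1, θ.2.1, y.1) + c₂ * G (θ.1, θ.2.2, y.1) + c₃ * H y.2) := fun θ =>
    hm.comp (measurable_prodMk_left (x := θ))
  rw [← hpa.lintegral_comp hF, ← hpv.lintegral_comp hG, ← hpz.lintegral_comp hH,
    ← lintegral_const_mul _ h2, ← lintegral_const_mul _ h3, ← lintegral_add_left h1,
    ← lintegral_add_right _ (h3.const_mul _), ← lintegral_const_mul _ hs,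
    lintegral_prod _ hm.aemeasurable]
  exact lintegral_congr fun θ => (lintegral_prod _ (hms θ).aemeasurable).symm

/-- Fourth power of a linear readout of the post-activations of layer `ℓ`. -/
def readoutFour (φ : ℝ → ℝ) (d : ℕ → ℕ) (L ℓ : ℕ)
    (y : Wspace d L × (Fin (d ℓ) → ℝ) × (Fin (d 0) → ℝ)) : ENNReal :=
  ENNReal.ofReal (((∑ i, y.2.1 i * feat φ d (extW y.1) y.2.2 ℓ i) / Real.sqrt (d ℓ : ℝ)) ^ 4)

lemma measurable_readoutFour {φ : ℝ → ℝ} (hφ : Measurable φ) (d : ℕ → ℕ) (L ℓ : ℕ) :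
    Measurable (readoutFour φ d L ℓ) :=
  ((measurable_readout hφ d L ℓ).pow_const 4).ennreal_ofReal

lemma lintegral_readoutFour_le {φ : ℝ → ℝ} (hφ : Measurable φ) {d : ℕ → ℕ} {L ℓ : ℕ}
    (hd : 1 ≤ d ℓ) {M : ENNReal} (hM : ∀ i, ∫⁻ W : Wspace d L, ∫⁻ x,
      ENNReal.ofReal (feat φ d (extW W) x ℓ i ^ 4) ∂(stdGPi (d 0)) ∂(Wmeasure d L) ≤ M) :
    ∫⁻ y, readoutFour φ d L ℓ y ∂((Wmeasure d L).prod ((stdGPi (d ℓ)).prod (stdGPi (d 0)))) ≤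
      gaussFour * M := by
  rw [lintegral_prod_prod_swap (measurable_readoutFour hφ d L ℓ)]
  refine le_trans ?_ (lintegral_average_feat_four_le hφ hd hM)
  refine lintegral_mono fun W => lintegral_mono fun x => ?_
  exact lintegral_four_readout_le hd fun i => feat φ d (extW W) x ℓ i

lemma interpSig_four_le (φ : ℝ → ℝ) (d : ℕ → ℕ) (L : ℕ) {t : ℝ} (ht0 : 0 ≤ t) (ht1 : t ≤ 1)
    (W : Wspace d L) (a : Fin (d L) → ℝ) (v : Fin (d (L - 1)) → ℝ) (ζ : ℝ)
    (x : Fin (d 0) → ℝ) :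
    interpSig φ d L t W a v ζ x ^ 4 ≤ 27 *
      (((∑ i, a i * feat φ d (extW W) x L i) / Real.sqrt (d L : ℝ)) ^ 4 +
        rhoC φ L ^ 4 *
          ((∑ i, v i * feat φ d (extW W) x (L - 1) i) / Real.sqrt (d (L - 1) : ℝ)) ^ 4 +
        epsC φ L ^ 2 * ζ ^ 4) := by
  have hs1 : Real.sqrt (1 - t) ^ 4 ≤ 1 := by
    rw [show Real.sqrt (1 - t) ^ 4 = (Real.sqrt (1 - t) ^ 2) ^ 2 by ring,
      Real.sq_sqrt (by linarith)]
    nlinarith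
  have hs2 : Real.sqrt t ^ 4 ≤ 1 := by
    rw [show Real.sqrt t ^ 4 = (Real.sqrt t ^ 2) ^ 2 by ring, Real.sq_sqrt ht0]
    nlinarith
  have hs3 : Real.sqrt (t * epsC φ L) ^ 4 ≤ epsC φ L ^ 2 := by
    rcases le_total 0 (epsC φ L) with h | h
    · rw [show Real.sqrt (t * epsC φ L) ^ 4 = (Real.sqrt (t * epsC φ L) ^ 2) ^ 2 by ring,
        Real.sq_sqrt (mul_nonneg ht0 h)]
      exact pow_le_pow_left₀ (mul_nonneg ht0 h) (mul_le_of_le_one_left h ht1) 2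
    · rw [Real.sqrt_eq_zero_of_nonpos (mul_nonpos_of_nonneg_of_nonpos ht0 h)]
      simpa using sq_nonneg (epsC φ L)
  refine (add_add_pow_four_le _ _ _).trans ?_
  unfold netOut
  simp only [mul_pow]
  gcongr
  · exact mul_le_of_le_one_left (by positivity) hs1
  · exact mul_le_of_le_one_left (by positivity) hs2

/-- The fourth moment of the interpolating signal is bounded independently of the widths and of
the interpolation time. -/
lemma lintegral_signalMoment_le {φ : ℝ → ℝ} (hφ : Measurable φ) {K : ℝ}
    (hK : ∀ x, |φ x| ≤ K * |x|) {d : ℕ → ℕ} {L : ℕ} (hd : ∀ ℓ ≤ L, 1 ≤ d ℓ) {t : ℝ}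
    (ht0 : 0 ≤ t) (ht1 : t ≤ 1) :
    ∫⁻ θ, signalMoment φ d L t θ ∂(psi3Measure d L) ≤ ENNReal.ofReal 27 *
      (gaussFour * ((ENNReal.ofReal (K ^ 4) * gaussFour) ^ L * gaussFour) +
        ENNReal.ofReal (rhoC φ L ^ 4) *
          (gaussFour * ((ENNReal.ofReal (K ^ 4) * gaussFour) ^ (L - 1) * gaussFour)) +
        ENNReal.ofReal (epsC φ L ^ 2) * gaussFour) := by
  have hle : ∀ ℓ ≤ L, _ := fun ℓ hℓ =>
    lintegral_readoutFour_le hφ (hd ℓ hℓ) (lintegral_feat_four_le hφ hK hd ℓ hℓ)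
  have hz : Measurable fun z : ℝ => ENNReal.ofReal (z ^ 4) := by fun_prop
  calc _ ≤ ∫⁻ θ, ∫⁻ x, ∫⁻ ζ, ENNReal.ofReal 27 * (readoutFour φ d L L (θ.1, θ.2.1, x) +
        ENNReal.ofReal (rhoC φ L ^ 4) * readoutFour φ d L (L - 1) (θ.1, θ.2.2, x) +
        ENNReal.ofReal (epsC φ L ^ 2) * ENNReal.ofReal (ζ ^ 4)) ∂stdG ∂(stdGPi (d 0))
        ∂(psi3Measure d L) := by
        refine lintegral_mono fun θ => lintegral_mono fun x => lintegral_mono fun ζ => ?_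
        refine (ENNReal.ofReal_le_ofReal
          (interpSig_four_le φ d L ht0 ht1 θ.1 θ.2.1 θ.2.2 ζ x)).trans_eq ?_
        unfold readoutFour
        rw [ENNReal.ofReal_mul (by norm_num), ENNReal.ofReal_add (by positivity) (by positivity),
          ENNReal.ofReal_add (by positivity) (by positivity), ENNReal.ofReal_mul (by positivity),
          ENNReal.ofReal_mul (by positivity)]
    _ = _ := lintegral_add_add_marginals (measurable_readoutFour hφ d L L)
        (measurable_readoutFour hφ d L (L - 1)) hz _ _ _
    _ ≤ _ := by
        gcongr
        · exact hle L le_rfl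
        · exact hle (L - 1) (Nat.sub_le _ _)
        · exact le_rfl

lemma ofReal_sq_integral_le {α : Type*} [MeasurableSpace α] {μ : Measure α}
    [IsProbabilityMeasure μ] {X : α → ℝ} (hX : MemLp X 2 μ) :
    ENNReal.ofReal ((∫ x, X x ∂μ) ^ 2) ≤ ∫⁻ x, ENNReal.ofReal (X x ^ 2) ∂μ := by
  rw [← ofReal_integral_eq_lintegral_ofReal hX.integrable_sq (ae_of_all _ fun x => sq_nonneg _)]
  exact ENNReal.ofReal_le_ofReal (sq_integral_le_integral_sq hX)

/-- Averaging over part of the randomness does not increase the conditional variance. -/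
lemma integral_sq_partial_mean_sub_le {Θ α β : Type*} [MeasurableSpace Θ] [MeasurableSpace α]
    [MeasurableSpace β] {π : Measure Θ} {μ : Measure α} {ν : Measure β} [IsProbabilityMeasure π]
    [IsProbabilityMeasure μ] [IsProbabilityMeasure ν] {G : Θ → α × β → ℝ}
    (hG : MemLp (fun y : Θ × α × β => G y.1 y.2) 2 (π.prod (μ.prod ν))) {M : ℝ} (hM : 0 ≤ M)
    (hle : ∫⁻ θ, ∫⁻ x, ENNReal.ofReal ((G θ x - ∫ x', G θ x' ∂(μ.prod ν)) ^ 2) ∂(μ.prod ν) ∂π ≤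
      ENNReal.ofReal M) :
    ∫ y : β × Θ, ((∫ a, G y.2 (a, y.1) ∂μ) - ∫ b, ∫ a, G y.2 (a, b) ∂μ ∂ν) ^ 2 ∂(ν.prod π) ≤
      M := by
  by_cases hi : Integrable (fun y : β × Θ =>
    ((∫ a, G y.2 (a, y.1) ∂μ) - ∫ b, ∫ a, G y.2 (a, b) ∂μ ∂ν) ^ 2) (ν.prod π)
  swap
  · rwa [integral_undef hi]
  rw [← ENNReal.ofReal_le_ofReal_iff hM, ofReal_integral_eq_lintegral_ofReal hi
    (ae_of_all _ fun y => sq_nonneg _), lintegral_prod_symm _ hi.1.aemeasurable.ennreal_ofReal]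
  refine le_trans (lintegral_mono_ae ?_) hle
  filter_upwards [memLp_two_section_ae hG] with θ hθ
  have hc : ∫ b, ∫ a, G θ (a, b) ∂μ ∂ν = ∫ x', G θ x' ∂(μ.prod ν) :=
    (integral_prod_symm _ (hθ.integrable (by norm_num))).symm
  have hθc : MemLp (fun x => G θ x - ∫ x', G θ x' ∂(μ.prod ν)) 2 (μ.prod ν) :=
    hθ.sub (memLp_const _)
  rw [hc, lintegral_prod_symm _ (hθc.1.aemeasurable.pow_const 2).ennreal_ofReal]
  refine lintegral_mono_ae ?_
  filter_upwards [memLp_two_section_ae (H := fun y : β × α => G θ y.swap)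
    (hθ.comp_measurePreserving Measure.measurePreserving_swap)] with b hb
  refine le_trans (le_of_eq ?_) (ofReal_sq_integral_le
    (hb.sub (memLp_const (∫ x', G θ x' ∂(μ.prod ν)))))
  refine congrArg (fun r => ENNReal.ofReal (r ^ 2)) (Eq.symm ?_)
  refine (integral_sub (hb.integrable (by norm_num)) (integrable_const _)).trans ?_
  rw [integral_const, probReal_univ, one_smul]
  rfl

/-- Independent families of pairs are the same as pairs of independent families. -/
lemma measurePreserving_zip {ι X Y Z A : Type*} [Fintype ι] [MeasurableSpace X]
    [MeasurableSpace Y] [MeasurableSpace Z] [MeasurableSpace A] (μ : Measure X) (ν : Measure Y)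
    (ξ : Measure Z) (α : Measure A) [SigmaFinite μ] [SigmaFinite ν] [SigmaFinite ξ]
    [SigmaFinite α] :
    MeasurePreserving (fun (x : ((ι → X) × (ι → Y) × (ι → Z)) × (ι → A)) (i : ι) =>
        ((x.1.1 i, x.1.2.1 i, x.1.2.2 i), x.2 i))
      (((Measure.pi fun _ => μ).prod ((Measure.pi fun _ => ν).prod (Measure.pi fun _ => ξ))).prod
        (Measure.pi fun _ => α))
      (Measure.pi fun _ => (μ.prod (ν.prod ξ)).prod α) := by
  have h1 := (measurePreserving_arrowProdEquivProdArrow Y Z ι (fun _ => ν) fun _ => ξ).symm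
  have h2 := (measurePreserving_arrowProdEquivProdArrow X (Y × Z) ι (fun _ => μ)
    fun _ => ν.prod ξ).symm
  have h3 := (measurePreserving_arrowProdEquivProdArrow (X × Y × Z) A ι
    (fun _ => μ.prod (ν.prod ξ)) fun _ => α).symm
  exact h3.comp ((h2.comp ((MeasurePreserving.id _).prod h1)).prod (MeasurePreserving.id _))

/-- Private variables can be integrated out sample by sample. -/
lemma integral_prod_private {α β γ ζ : Type*} [MeasurableSpace α] [MeasurableSpace β]
    [MeasurableSpace γ] [MeasurableSpace ζ] {μ : Measure α} {ν : Measure β} {ξ : Measure γ}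
    {η : Measure ζ} [IsProbabilityMeasure μ] [IsProbabilityMeasure ν] [IsProbabilityMeasure ξ]
    [IsProbabilityMeasure η] {n : ℕ} {g : Fin n → α × β × γ → ζ → ℝ} {B : ℝ}
    (hg : ∀ j, Measurable (Function.uncurry (g j))) (hB : ∀ j θ z, |g j θ z| ≤ B) :
    ∫ τ : α × β × γ × (Fin n → ζ), ∏ j, g j (τ.1, τ.2.1, τ.2.2.1) (τ.2.2.2 j)
        ∂(μ.prod (ν.prod (ξ.prod (Measure.pi fun _ => η)))) =
      ∫ θ, ∏ j, ∫ z, g j θ z ∂η ∂(μ.prod (ν.prod ξ)) := by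
  have hT : MeasurePreserving (fun y : (α × β × γ) × (Fin n → ζ) =>
      (y.1.1, y.1.2.1, y.1.2.2, y.2)) ((μ.prod (ν.prod ξ)).prod (Measure.pi fun _ => η))
      (μ.prod (ν.prod (ξ.prod (Measure.pi fun _ => η)))) :=
    ((MeasurePreserving.id μ).prod (measurePreserving_prodAssoc ν ξ _)).comp
      (measurePreserving_prodAssoc μ (ν.prod ξ) _)
  have hm : Measurable fun y : (α × β × γ) × (Fin n → ζ) => ∏ j, g j y.1 (y.2 j) :=
    Finset.measurable_prod _ fun j _ =>
      (hg j).comp (measurable_fst.prodMk ((measurable_pi_apply j).comp measurable_snd))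
  have hm' : Measurable fun τ : α × β × γ × (Fin n → ζ) =>
      ∏ j, g j (τ.1, τ.2.1, τ.2.2.1) (τ.2.2.2 j) :=
    hm.comp (f := fun τ : α × β × γ × (Fin n → ζ) => ((τ.1, τ.2.1, τ.2.2.1), τ.2.2.2))
      (by fun_prop)
  rw [← hT.map_eq, integral_map hT.measurable.aemeasurable hm'.aestronglyMeasurable,
    integral_prod (fun y : (α × β × γ) × (Fin n → ζ) => ∏ j, g j y.1 (y.2 j))]
  · exact integral_congr_ae (ae_of_all _ fun θ =>
      integral_fintype_prod_eq_prod (μ := fun _ => η) fun j z => g j θ z)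
  · refine Integrable.of_bound hm.aestronglyMeasurable (B ^ n) (ae_of_all _ fun y => ?_)
    rw [Real.norm_eq_abs, Finset.abs_prod]
    calc _ ≤ ∏ _j : Fin n, B := Finset.prod_le_prod (fun j _ => abs_nonneg _) fun j _ => hB _ _ _
      _ = B ^ n := by simp

lemma abs_le_mul_abs_of_odd {g : ℝ → ℝ} (hg : Differentiable ℝ g) (hodd : ∀ x, g (-x) = -g x)
    {K : ℝ} (hK : ∀ x, |deriv g x| ≤ K) (x : ℝ) : |g x| ≤ K * |x| := by
  have h0 : g 0 = 0 := by
    have := hodd 0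
    rw [neg_zero] at this
    linarith
  have := Convex.norm_image_sub_le_of_norm_deriv_le (s := Set.univ) (x := 0) (y := x)
    (fun x _ => hg x) (fun x _ => hK x) convex_univ (Set.mem_univ _) (Set.mem_univ _)
  simpa [h0] using this

lemma Pout_nonneg {p : ℕ} {PA : Measure (Fin p → ℝ)} {Δ : ℝ} {f : ℝ → (Fin p → ℝ) → ℝ}
    (hΔ : 0 < Δ) (y x : ℝ) : 0 ≤ Pout PA Δ f y x :=
  integral_nonneg fun _ => (gaussian_kernel_pos hΔ _ _).le

section Interpolation

variable {p : ℕ} {PA : Measure (Fin p → ℝ)} [IsProbabilityMeasure PA] {Δ : ℝ} {φ : ℝ → ℝ}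
  {f : ℝ → (Fin p → ℝ) → ℝ}

lemma Pout_le (hΔ : 0 < Δ) (y x : ℝ) : Pout PA Δ f y x ≤ 1 / Real.sqrt (2 * Real.pi * Δ) := by
  refine (integral_mono_of_nonneg (ae_of_all _ fun A => (gaussian_kernel_pos hΔ y (f x A)).le)
    (integrable_const _) (ae_of_all _ fun A => gaussian_kernel_le hΔ y (f x A))).trans ?_
  simp

lemma measurable_Pout (hf : Measurable (Function.uncurry f)) (y : ℝ) :
    Measurable (Pout PA Δ f y) := by
  have h : Measurable fun z : ℝ × (Fin p → ℝ) =>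
      Real.exp (-(y - Function.uncurry f z) ^ 2 / (2 * Δ)) / Real.sqrt (2 * Real.pi * Δ) := by
    fun_prop
  exact h.stronglyMeasurable.integral_prod_right.measurable

/-- The interpolating partition function is the partition function of the samples produced by the
teacher. -/
lemma ZtI_eq_integral_prod_likelihood (hΔ : 0 < Δ) (hφ : Measurable φ)
    (hf : Measurable (Function.uncurry f)) (d : ℕ → ℕ) (L n : ℕ) (t : ℝ)
    (ω : interpSpace d L p n) :
    ZtI L p PA Δ φ f d n t ω = ∫ θ, ∏ j, likelihood PA Δ φ f d L t θ
      (observation Δ φ f d L t ω.2.2 ((ω.1.1 j, ω.1.2.1 j, ω.1.2.2 j), ω.2.1 j))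
      ∂(psi3Measure d L) := by
  refine integral_prod_private (B := 1 / Real.sqrt (2 * Real.pi * Δ))
    (g := fun j (θ : psi3Space d L) ζ => Pout PA Δ f (YtI φ f d L n Δ t ω j)
      (interpSig φ d L t θ.1 θ.2.1 θ.2.2 ζ (ω.1.1 j))) (fun j => ?_) fun j θ z => ?_
  · exact (measurable_Pout hf _).comp ((measurable_interpSig hφ d L t).comp
      (f := fun y : psi3Space d L × ℝ => (y.1, ω.1.1 j, y.2)) (by fun_prop))
  · rw [abs_of_nonneg (Pout_nonneg hΔ _ _)]
    exact Pout_le hΔ _ _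

end Interpolation

/-- **Lemma G.4 (Free entropy concentration w.r.t. the channel randomness `A`).**
With `h(A) = E_{ψ₁}[(1/n) log Z_t]`, uniformly in `t ∈ [0,1]`,
`E(h(A) − E_A h(A))² ≤ C(f,φ)/n`. -/
theorem free_entropy_concentration_A
    (L p : ℕ) (hL : 1 ≤ L)
    (PA : Measure (Fin p → ℝ)) [IsProbabilityMeasure PA]
    (Δ : ℝ) (hΔ : 0 < Δ)
    (φ : ℝ → ℝ) (f : ℝ → (Fin p → ℝ) → ℝ)
    (hφC2 : ContDiff ℝ 2 φ) (hφodd : ∀ x, φ (-x) = -φ x)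
    (hφbd : ∃ K, ∀ x, |deriv φ x| ≤ K ∧ |deriv (deriv φ) x| ≤ K)
    (hfC2 : ∀ A, ContDiff ℝ 2 (fun x => f x A))
    (hfodd : ∀ x A, f (-x) A = -f x A)
    (hfbd : ∃ K, ∀ x A, |deriv (fun x' => f x' A) x| ≤ K ∧
      |deriv (deriv (fun x' => f x' A)) x| ≤ K)
    (hfmeas : Measurable (Function.uncurry f))
 :
    ∃ C > 0, ∀ n : ℕ, 1 ≤ n → ∀ d : ℕ → ℕ, (∀ ℓ ≤ L, 1 ≤ d ℓ) →
      ∀ t : ℝ, 0 ≤ t → t ≤ 1 →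
      ∫ ω₂₃ : psi2Space p n × psi3Space d L,
          ((∫ ω₁, (1 / (n : ℝ)) * Real.log (ZtI L p PA Δ φ f d n t (ω₁, ω₂₃))
              ∂(psi1Measure d n)) -
            ∫ ω₂', ∫ ω₁, (1 / (n : ℝ)) * Real.log (ZtI L p PA Δ φ f d n t (ω₁, ω₂', ω₂₃.2))
              ∂(psi1Measure d n) ∂(psi2Measure p n PA)) ^ 2
        ∂((psi2Measure p n PA).prod (psi3Measure d L)) ≤ C / (n : ℝ) := by
  obtain ⟨Kφ, hKφ⟩ := hφbd
  obtain ⟨Kf, hKf⟩ := hfbd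
  have hφ : Measurable φ := hφC2.continuous.measurable
  have hφlin := abs_le_mul_abs_of_odd (hφC2.differentiable (by norm_num)) hφodd
    fun x => (hKφ x).1
  have hflin : ∀ x A, |f x A| ≤ Kf * |x| := fun x A =>
    abs_le_mul_abs_of_odd ((hfC2 A).differentiable (by norm_num)) (fun x => hfodd x A)
      (fun x => (hKf x A).1) x
  set Q : ENNReal := ENNReal.ofReal 27 *
      (gaussFour * ((ENNReal.ofReal (Kφ ^ 4) * gaussFour) ^ L * gaussFour) +
        ENNReal.ofReal (rhoC φ L ^ 4) *
          (gaussFour * ((ENNReal.ofReal (Kφ ^ 4) * gaussFour) ^ (L - 1) * gaussFour)) +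
        ENNReal.ofReal (epsC φ L ^ 2) * gaussFour)
  set T : ENNReal := 2 * (ENNReal.ofReal (27 * Kf ^ 4 / (4 * Δ ^ 2)) * Q +
    ENNReal.ofReal (27 / 4) * gaussFour)
  have hg : gaussFour ≠ ⊤ := gaussFour_lt_top.ne
  have hT : T ≠ ⊤ := by finiteness
  refine ⟨T.toReal + 1, by positivity, fun n hn d hd t ht0 ht1 => ?_⟩
  have hn0 : (0 : ℝ) < n := by exact_mod_cast hn
  refine le_trans ?_ (div_le_div_of_nonneg_right (le_add_of_nonneg_right zero_le_one) hn0.le)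
  let S : psi3Space d L → ENNReal := fun θ =>
    ENNReal.ofReal (27 * Kf ^ 4 / (4 * Δ ^ 2)) * signalMoment φ d L t θ +
      ENNReal.ofReal (27 / 4) * gaussFour
  have hSm : Measurable S := ((measurable_signalMoment hφ d L t).const_mul _).add_const _
  have hST : 2 * ∫⁻ θ, S θ ∂(psi3Measure d L) ≤ T := by
    refine mul_le_mul_right ?_ _
    rw [lintegral_add_right _ measurable_const, lintegral_const, measure_univ, mul_one,
      lintegral_const_mul' _ _ ENNReal.ofReal_ne_top]
    gcongr
    exact lintegral_signalMoment_le hφ hφlin hd ht0 ht1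
  have hSfin : ∫⁻ θ, S θ ∂(psi3Measure d L) ≠ ⊤ := fun h => by
    rw [h, ENNReal.mul_top two_ne_zero, top_le_iff] at hST
    exact hT hST
  have hom := measurable_observation (Δ := Δ) hφ hfmeas d L t
  have hqm := measurable_likelihood (PA := PA) hΔ hφ hfmeas d L t
  have hq := likelihood_pos (PA := PA) hΔ hφ hfmeas d L t
  have hqB := likelihood_le (PA := PA) hΔ hφ hfmeas d L t
  have hlaw := map_observation (PA := PA) hΔ hφ hfmeas d L t
  have hRS := lintegral_sq_log_likelihood_le (PA := PA) hΔ hφ hfmeas hflin d L t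
  have hL2 := memLp_two_logPart hom hqm hq hqB hlaw hSm hRS hSfin n
  have hvar := (lintegral_sq_logPart_sub_mean_le hom hqm hq hqB hlaw hSm hRS hSfin n).trans
    (mul_le_mul_right hST _)
  have hzip : MeasurePreserving (fun (x : psi1Space d n × psi2Space p n) (j : Fin n) =>
      ((x.1.1 j, x.1.2.1 j, x.1.2.2 j), x.2 j)) ((psi1Measure d n).prod (psi2Measure p n PA))
      (Measure.pi fun _ => sampleMeasure d PA) :=
    measurePreserving_zip (stdGPi (d 0)) stdG stdG PA
  have hG := (hL2.comp_measurePreserving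
    ((MeasurePreserving.id (psi3Measure d L)).prod hzip)).const_mul (1 / (n : ℝ))
  have hlm : ∀ θ, Measurable fun v : Fin n → ((Fin (d 0) → ℝ) × ℝ × ℝ) × (Fin p → ℝ) =>
      logPart (psi3Measure d L) (likelihood PA Δ φ f d L t)
        fun j => observation Δ φ f d L t θ (v j) := fun θ =>
    (measurable_logPart hqm n).comp (measurable_pi_lambda _ fun j =>
      hom.of_uncurry_left.comp (measurable_pi_apply j))
  have hmain := integral_sq_partial_mean_sub_le (π := psi3Measure d L) (μ := psi1Measure d n)
    (ν := psi2Measure p n PA) (G := fun θ x => 1 / (n : ℝ) * logPart (psi3Measure d L)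
      (likelihood PA Δ φ f d L t) fun j => observation Δ φ f d L t θ
        ((x.1.1 j, x.1.2.1 j, x.1.2.2 j), x.2 j)) hG (M := T.toReal / n) (by positivity) ?_
  · simp only [ZtI_eq_integral_prod_likelihood hΔ hφ hfmeas]
    exact hmain
  · calc _ = ENNReal.ofReal ((1 / (n : ℝ)) ^ 2) * ∫⁻ θ, ∫⁻ v, ENNReal.ofReal
          ((logPart (psi3Measure d L) (likelihood PA Δ φ f d L t)
              (fun j => observation Δ φ f d L t θ (v j)) -
            ∫ v', logPart (psi3Measure d L) (likelihood PA Δ φ f d L t)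
              (fun j => observation Δ φ f d L t θ (v' j))
              ∂(Measure.pi fun _ : Fin n => sampleMeasure d PA)) ^ 2)
          ∂(Measure.pi fun _ : Fin n => sampleMeasure d PA) ∂(psi3Measure d L) := by
          rw [← lintegral_const_mul' _ _ ENNReal.ofReal_ne_top]
          refine lintegral_congr fun θ => ?_
          rw [← lintegral_const_mul' _ _ ENNReal.ofReal_ne_top, ← hzip.lintegral_comp (by
            have := hlm θ
            fun_prop), integral_const_mul, ← hzip.map_eq,
            integral_map hzip.measurable.aemeasurable (hlm θ).aestronglyMeasurable]
          refine lintegral_congr fun x => ?_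
          rw [← ENNReal.ofReal_mul (by positivity), ← mul_pow, mul_sub]
      _ ≤ ENNReal.ofReal ((1 / (n : ℝ)) ^ 2) * (n * T) := mul_le_mul_right hvar _
      _ = ENNReal.ofReal (T.toReal / n) := by
          rw [← ENNReal.ofReal_toReal hT, ← ENNReal.ofReal_natCast,
            ← ENNReal.ofReal_mul hn0.le, ← ENNReal.ofReal_mul (by positivity)]
          congr 1
          rw [ENNReal.ofReal_toReal hT]
          field_simp

end
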